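/- Each of the Jacobi–Eisenstein series E_{4,1}, E_{4,2}, E_{4,3}, E_{6,1}, E_{6,2} has integral Fourier coefficients: for each of these series there exist integers f(n,l) (n ∈ ℕ, l ∈ ℤ) such that the series equals Σ_{n≥0, l∈ℤ} f(n,l) q^n ζ^l on ℍ×ℂ. -/

import Mathlib

noncomputable section

open Complex

namespace JacobiPaper

/-- `e2 w = e^{2 π i w}`. -/
def e2 (w : ℂ) : ℂ := Complex.exp (2 * (Real.pi : ℂ) * Complex.I * w)

/-- `q = e^{2 π i τ}`. -/
def qC (τ : ℂ) : ℂ := e2 τ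

/-- `ζ = e^{2 π i z}`. -/
def zetaC (z : ℂ) : ℂ := e2 z

/-- The Dedekind eta function `η(τ) = q^{1/24} ∏_{n ≥ 1} (1 - qⁿ)`. -/
def eta (τ : ℂ) : ℂ :=
  Complex.exp ((Real.pi : ℂ) * Complex.I * τ / 12) * ∏' n : ℕ, (1 - qC τ ^ (n + 1))

/-- The odd Jacobi theta function
`ϑ(τ,z) = q^{1/8} (ζ^{1/2} - ζ^{-1/2}) ∏_{n ≥ 1} (1 - qⁿζ)(1 - qⁿζ⁻¹)(1 - qⁿ)`. -/
def theta (τ z : ℂ) : ℂ :=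
  Complex.exp ((Real.pi : ℂ) * Complex.I * τ / 4) *
    (Complex.exp ((Real.pi : ℂ) * Complex.I * z) - Complex.exp (-((Real.pi : ℂ) * Complex.I * z))) *
    ∏' n : ℕ,
      ((1 - qC τ ^ (n + 1) * zetaC z) * (1 - qC τ ^ (n + 1) * (zetaC z)⁻¹) * (1 - qC τ ^ (n + 1)))

/-- `ϑ₀₀(τ,z) = Σ_{n ∈ ℤ} q^{n²/2} ζⁿ`. -/
def theta00 (τ z : ℂ) : ℂ :=
  ∑' n : ℤ, Complex.exp ((Real.pi : ℂ) * Complex.I * (n : ℂ) ^ 2 * τ +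
    2 * (Real.pi : ℂ) * Complex.I * (n : ℂ) * z)

/-- `ϑ₀₁(τ,z) = Σ_{n ∈ ℤ} (-1)ⁿ q^{n²/2} ζⁿ`. -/
def theta01 (τ z : ℂ) : ℂ :=
  ∑' n : ℤ, (-1 : ℂ) ^ n * Complex.exp ((Real.pi : ℂ) * Complex.I * (n : ℂ) ^ 2 * τ +
    2 * (Real.pi : ℂ) * Complex.I * (n : ℂ) * z)

/-- `ϑ₁₀(τ,z) = q^{1/8} ζ^{1/2} Σ_{n ∈ ℤ} q^{n(n+1)/2} ζⁿ`. -/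
def theta10 (τ z : ℂ) : ℂ :=
  Complex.exp ((Real.pi : ℂ) * Complex.I * τ / 4) * Complex.exp ((Real.pi : ℂ) * Complex.I * z) *
    ∑' n : ℤ, Complex.exp ((Real.pi : ℂ) * Complex.I * (n : ℂ) * ((n : ℂ) + 1) * τ +
      2 * (Real.pi : ℂ) * Complex.I * (n : ℂ) * z)

/-- `ξ₀₀(τ,z) = ϑ₀₀(τ,z)/ϑ₀₀(τ,0)`. -/
def xi00 (τ z : ℂ) : ℂ := theta00 τ z / theta00 τ 0

/-- `ξ₀₁(τ,z) = ϑ₀₁(τ,z)/ϑ₀₁(τ,0)`. -/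
def xi01 (τ z : ℂ) : ℂ := theta01 τ z / theta01 τ 0

/-- `ξ₁₀(τ,z) = ϑ₁₀(τ,z)/ϑ₁₀(τ,0)`. -/
def xi10 (τ z : ℂ) : ℂ := theta10 τ z / theta10 τ 0

/-- The weak Jacobi form `φ_{0,1} = 4(ξ₀₀² + ξ₀₁² + ξ₁₀²)`. -/
def phi01 (τ z : ℂ) : ℂ := 4 * (xi00 τ z ^ 2 + xi01 τ z ^ 2 + xi10 τ z ^ 2)

/-- The weak Jacobi form `φ_{0,2}(τ,z) = 2(ξ₀₀ + ξ₀₁ + ξ₁₀)(τ,2z)`. -/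
def phi02 (τ z : ℂ) : ℂ := 2 * (xi00 τ (2 * z) + xi01 τ (2 * z) + xi10 τ (2 * z))

/-- The weak Jacobi form `φ_{0,3}(τ,z) = ϑ(τ,2z)²/ϑ(τ,z)²`. -/
def phi03 (τ z : ℂ) : ℂ := theta τ (2 * z) ^ 2 / theta τ z ^ 2

/-- The weak Jacobi form `φ_{0,4}(τ,z) = ϑ(τ,3z)/ϑ(τ,z)`. -/
def phi04 (τ z : ℂ) : ℂ := theta τ (3 * z) / theta τ z

/-- The weak Jacobi form `φ_{-2,1}(τ,z) = ϑ(τ,z)²/η(τ)⁶`. -/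
def phiM21 (τ z : ℂ) : ℂ := theta τ z ^ 2 / eta τ ^ 6

/-- The divisor power sum `σ_k(n)`. -/
def sigma' (k n : ℕ) : ℕ := ∑ d ∈ n.divisors, d ^ k

/-- The normalized Eisenstein series `E_k(τ) = 1 - (2k/B_k) Σ_{n ≥ 1} σ_{k-1}(n) qⁿ`. -/
def Eis (k : ℕ) (τ : ℂ) : ℂ :=
  1 - (2 * (k : ℂ) / ((bernoulli k : ℚ) : ℂ)) *
    ∑' n : ℕ, (sigma' (k - 1) (n + 1) : ℂ) * qC τ ^ (n + 1)

/-- The discriminant cusp form `Δ = η²⁴`. -/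
def Delta (τ : ℂ) : ℂ := eta τ ^ 24

/-- The modular invariant `j = E₄³/Δ`. -/
def jInv (τ : ℂ) : ℂ := Eis 4 τ ^ 3 / Delta τ

/-- A choice of `(a, b)` with `a d - b c = 1` completing a coprime pair `(c, d)` to a matrix
`(a b; c d) ∈ SL₂(ℤ)`. -/
def bezout (c d : ℤ) : ℤ × ℤ :=
  haveI : Decidable (∃ ab : ℤ × ℤ, ab.1 * d - ab.2 * c = 1) := Classical.propDecidable _
  if h : ∃ ab : ℤ × ℤ, ab.1 * d - ab.2 * c = 1 then h.choose else 0

/-- The summand `(cτ+d)^{-k} Σ_{l ∈ ℤ} e^{2πim(l²(aτ+b)/(cτ+d) + 2lz/(cτ+d) - cz²/(cτ+d))}`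
of the Jacobi–Eisenstein series attached to a coprime pair `(c,d)`; it does not depend on the
choice of `(a,b)` completing `(c,d)` to an element of `SL₂(ℤ)`. -/
def EisJSummand (k m : ℕ) (τ z : ℂ) (c d : ℤ) : ℂ :=
  ((c : ℂ) * τ + (d : ℂ)) ^ (-(k : ℤ)) *
    ∑' l : ℤ, e2 ((m : ℂ) * ((l : ℂ) ^ 2 * (((bezout c d).1 : ℂ) * τ + ((bezout c d).2 : ℂ)) /
        ((c : ℂ) * τ + (d : ℂ)) +
      2 * (l : ℂ) * z / ((c : ℂ) * τ + (d : ℂ)) - (c : ℂ) * z ^ 2 / ((c : ℂ) * τ + (d : ℂ))))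

/-- The Jacobi–Eisenstein series `E_{k,m}` of weight `k` and index `m`. -/
def EisJ (k m : ℕ) (τ z : ℂ) : ℂ :=
  (1 / 2) * ∑' p : {p : ℤ × ℤ // IsCoprime p.1 p.2}, EisJSummand k m τ z p.1.1 p.1.2

/-- `F_{6,3} = (1/2)(E_{6,1} φ_{0,2} - E₆ φ_{0,3})`. -/
def F63 (τ z : ℂ) : ℂ := (1 / 2) * (EisJ 6 1 τ z * phi02 τ z - Eis 6 τ * phi03 τ z)

/-- A weak Jacobi form of weight `k ∈ ℤ` and index `m ∈ ℕ`: a holomorphic function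
`φ : ℍ × ℂ → ℂ` satisfying the two Jacobi transformation laws and having a Fourier expansion
`φ(τ,z) = Σ_{n ≥ 0, l ∈ ℤ} f(n,l) qⁿ ζˡ`. -/
def IsWeakJacobiForm (k : ℤ) (m : ℕ) (φ : ℂ → ℂ → ℂ) (f : ℕ → ℤ → ℂ) : Prop :=
  DifferentiableOn ℂ (fun p : ℂ × ℂ => φ p.1 p.2) {p : ℂ × ℂ | 0 < p.1.im} ∧
  (∀ a b c d : ℤ, a * d - b * c = 1 → ∀ τ z : ℂ, 0 < τ.im →
    φ (((a : ℂ) * τ + (b : ℂ)) / ((c : ℂ) * τ + (d : ℂ))) (z / ((c : ℂ) * τ + (d : ℂ))) =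
      ((c : ℂ) * τ + (d : ℂ)) ^ k *
        e2 ((m : ℂ) * ((c : ℂ) * z ^ 2 / ((c : ℂ) * τ + (d : ℂ)))) * φ τ z) ∧
  (∀ x y : ℤ, ∀ τ z : ℂ, 0 < τ.im →
    φ τ (z + (x : ℂ) * τ + (y : ℂ)) =
      e2 (-(m : ℂ) * ((x : ℂ) ^ 2 * τ + 2 * (x : ℂ) * z)) * φ τ z) ∧
  (∀ τ z : ℂ, 0 < τ.im →
    HasSum (fun p : ℕ × ℤ => f p.1 p.2 * e2 ((p.1 : ℂ) * τ + (p.2 : ℂ) * z)) (φ τ z))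

/-- A weakly holomorphic Jacobi form of weight `0` and index `m ∈ ℕ`: as a weak Jacobi form,
but the Fourier expansion `φ(τ,z) = Σ_{n ≥ n₀, l ∈ ℤ} f(n,l) qⁿ ζˡ` may contain finitely many
negative powers of `q`. -/
def IsWeaklyHolomorphicJacobiForm0 (m : ℕ) (φ : ℂ → ℂ → ℂ) (f : ℤ → ℤ → ℂ) : Prop :=
  DifferentiableOn ℂ (fun p : ℂ × ℂ => φ p.1 p.2) {p : ℂ × ℂ | 0 < p.1.im} ∧
  (∀ a b c d : ℤ, a * d - b * c = 1 → ∀ τ z : ℂ, 0 < τ.im →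
    φ (((a : ℂ) * τ + (b : ℂ)) / ((c : ℂ) * τ + (d : ℂ))) (z / ((c : ℂ) * τ + (d : ℂ))) =
      e2 ((m : ℂ) * ((c : ℂ) * z ^ 2 / ((c : ℂ) * τ + (d : ℂ)))) * φ τ z) ∧
  (∀ x y : ℤ, ∀ τ z : ℂ, 0 < τ.im →
    φ τ (z + (x : ℂ) * τ + (y : ℂ)) =
      e2 (-(m : ℂ) * ((x : ℂ) ^ 2 * τ + 2 * (x : ℂ) * z)) * φ τ z) ∧
  (∃ n₀ : ℤ, ∀ n : ℤ, n < n₀ → ∀ l : ℤ, f n l = 0) ∧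
  (∀ τ z : ℂ, 0 < τ.im →
    HasSum (fun p : ℤ × ℤ => f p.1 p.2 * e2 ((p.1 : ℂ) * τ + (p.2 : ℂ) * z)) (φ τ z))

/-- A function `φ` on `ℍ × ℂ` has integral Fourier coefficients if it is the sum of a Fourier
series `Σ_{n ≥ 0, l ∈ ℤ} f(n,l) qⁿ ζˡ` with all `f(n,l) ∈ ℤ`. -/
def HasIntegralFourierExpansion (φ : ℂ → ℂ → ℂ) : Prop :=
  ∃ f : ℕ → ℤ → ℤ, ∀ τ z : ℂ, 0 < τ.im →
    HasSum (fun p : ℕ × ℤ => (f p.1 p.2 : ℂ) * e2 ((p.1 : ℂ) * τ + (p.2 : ℂ) * z)) (φ τ z)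

/-! ### A theta function of degree `2m` vanishing to order greater than `2m` is zero -/

lemma e2_add (x y : ℂ) : e2 (x + y) = e2 x * e2 y := by
  simp [e2, mul_add, Complex.exp_add]

lemma e2_ne_zero (x : ℂ) : e2 x ≠ 0 := Complex.exp_ne_zero _

lemma e2_zero : e2 0 = 1 := by simp [e2]

lemma e2_intCast (n : ℤ) : e2 n = 1 := by
  rw [e2, mul_comm]
  exact Complex.exp_int_mul_two_pi_mul_I n

lemma e2_eq_one_iff (x : ℂ) : e2 x = 1 ↔ ∃ n : ℤ, x = n := by
  constructor
  · intro h
    obtain ⟨n, hn⟩ := Complex.exp_eq_one_iff.mp h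
    refine ⟨n, ?_⟩
    have := Complex.two_pi_I_ne_zero
    apply mul_left_cancel₀ this
    rw [hn]; ring
  · rintro ⟨n, rfl⟩; exact e2_intCast n

lemma e2_neg (x : ℂ) : e2 (-x) = (e2 x)⁻¹ := by
  simp [e2, Complex.exp_neg]

lemma e2_nat_mul (n : ℕ) (x : ℂ) : e2 (n * x) = e2 x ^ n := by
  rw [e2, e2, ← Complex.exp_nat_mul]; congr 1; ring

lemma norm_e2 (x : ℂ) : ‖e2 x‖ = Real.exp (-2 * Real.pi * x.im) := by
  rw [e2, Complex.norm_exp]; congr 1; simp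

lemma norm_e2_lt_one {τ : ℂ} (hτ : 0 < τ.im) : ‖e2 τ‖ < 1 := by
  rw [norm_e2, Real.exp_lt_one_iff]
  have := mul_pos Real.pi_pos hτ
  linarith

lemma differentiable_e2 : Differentiable ℂ e2 := by unfold e2; fun_prop

/-- The infinite product `∏ (1 - qⁿ w)` as an entire function of `w`. -/
lemma exists_qProduct {q : ℂ} (hq : ‖q‖ < 1) : ∃ A : ℂ → ℂ, Differentiable ℂ A ∧ A 0 = 1 ∧
    ∀ w, A w = (1 - w) * A (q * w) := by
  have hs : ∀ w : ℂ, Summable fun n : ℕ => ‖-(q ^ n * w)‖ := fun w => by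
    simpa using (summable_geometric_of_lt_one (norm_nonneg q) hq).mul_right ‖w‖
  have hm : ∀ w : ℂ, Multipliable fun n : ℕ => 1 + -(q ^ n * w) := fun w =>
    multipliable_one_add_of_summable (hs w)
  refine ⟨fun w => ∏' n : ℕ, (1 + -(q ^ n * w)), ?_, by simp, fun w => ?_⟩
  · have hl : HasProdLocallyUniformlyOn (fun (n : ℕ) (w : ℂ) => 1 + -(q ^ n * w))
        (fun w => ∏' n : ℕ, (1 + -(q ^ n * w))) Set.univ := by
      apply hasProdLocallyUniformlyOn_of_forall_compact isOpen_univ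
      intro K _ hK
      obtain ⟨C, hC⟩ := hK.isBounded.exists_norm_le
      refine ((summable_geometric_of_lt_one (norm_nonneg q) hq).mul_right C).hasProdUniformlyOn_nat_one_add
        hK (.of_forall fun n x hx => ?_) (fun _ => by fun_prop)
      rw [norm_neg, norm_mul, norm_pow]
      exact mul_le_mul_of_nonneg_left (hC x hx) (by positivity)
    rw [← differentiableOn_univ]
    exact hl.differentiableOn (.of_forall fun _ => by
      simpa [Finset.prod_fn] using DifferentiableOn.finsetProd (fun _ _ => by fun_prop)) isOpen_univ
  · beta_reduce
    rw [tprod_eq_zero_mul' (f := fun n : ℕ => 1 + -(q ^ n * w))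
      ((hm (q * w)).congr fun n => by ring)]
    congr 1
    · ring
    · exact tprod_congr fun n => by ring

lemma exists_pow_mul_eq_one_of_qProduct_eq_zero {q : ℂ} (hq : ‖q‖ < 1) {A : ℂ → ℂ}
    (hA : Differentiable ℂ A) (hA0 : A 0 = 1) (hAq : ∀ w, A w = (1 - w) * A (q * w)) {w : ℂ}
    (hw : A w = 0) : ∃ n : ℕ, q ^ n * w = 1 := by
  by_contra! h
  have key : ∀ n : ℕ, A (q ^ n * w) = 0 := by
    intro n
    induction n with
    | zero => simpa using hw
    | succ n ih =>
      rw [hAq, mul_eq_zero, sub_eq_zero] at ih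
      rcases ih with ih | ih
      · exact absurd ih.symm (h n)
      · rw [← ih]; congr 1; ring
  have h0 : Filter.Tendsto (fun n : ℕ => A (q ^ n * w)) Filter.atTop (nhds (A (0 * w))) :=
    (hA.continuous.tendsto _).comp ((tendsto_pow_atTop_nhds_zero_of_norm_lt_one hq).mul_const w)
  simp [key, hA0] at h0

/-- An entire function with the zeros and the quasi-periodicity of the odd theta function. -/
lemma exists_thetaProduct {τ : ℂ} (hτ : 0 < τ.im) : ∃ P Q : ℂ → ℂ, Differentiable ℂ P ∧
    Differentiable ℂ Q ∧ Q 0 ≠ 0 ∧ (∀ z, P z = (1 - e2 z) * Q z) ∧ (∀ z, P (z + 1) = P z) ∧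
    (∀ z, P z = -e2 z * P (z + τ)) ∧ ∀ z, P z = 0 → ∃ a b : ℤ, z = a + b * τ := by
  have hq := norm_e2_lt_one hτ
  obtain ⟨A, hA, hA0, hAq⟩ := exists_qProduct hq
  have hz := @exists_pow_mul_eq_one_of_qProduct_eq_zero _ hq A hA hA0 hAq
  have he := differentiable_e2
  have h1 : ∀ z, e2 (z + 1) = e2 z := fun z => by
    rw [e2_add]; simpa using congrArg (e2 z * ·) (e2_intCast 1)
  refine ⟨fun z => A (e2 z) * A (e2 τ * e2 (-z)), fun z => A (e2 τ * e2 z) * A (e2 τ * e2 (-z)),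
    ?_, ?_, ?_, ?_, ?_, ?_, ?_⟩
  · exact (hA.comp he).mul (hA.comp ((differentiable_const _).mul (he.comp differentiable_neg)))
  · exact (hA.comp ((differentiable_const _).mul he)).mul
      (hA.comp ((differentiable_const _).mul (he.comp differentiable_neg)))
  · have : A (e2 τ) ≠ 0 := fun h => by
      obtain ⟨n, hn⟩ := hz h
      rw [← pow_succ] at hn
      have := congrArg norm hn
      rw [norm_pow, norm_one] at this
      exact (pow_lt_one₀ (norm_nonneg _) hq n.succ_ne_zero).ne this
    simpa [e2_zero] using this
  · intro z
    simp only
    rw [hAq (e2 z)]; ring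
  · intro z
    simp only [neg_add]
    rw [h1, ← h1 (-z + -1), neg_add_cancel_right]
  · intro z
    have h2 : e2 τ * e2 (-(z + τ)) = e2 (-z) := by rw [← e2_add]; congr 1; ring
    simp only
    rw [h2, hAq (e2 z), hAq (e2 (-z)), e2_add, mul_comm (e2 z) (e2 τ), e2_neg]
    have := e2_ne_zero z
    field_simp
    ring
  · intro z h
    rcases mul_eq_zero.mp h with h | h
    · obtain ⟨n, hn⟩ := hz h
      rw [← e2_nat_mul, ← e2_add, e2_eq_one_iff] at hn
      obtain ⟨k, hk⟩ := hn
      exact ⟨k, -n, by push_cast; linear_combination hk⟩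
    · obtain ⟨n, hn⟩ := hz h
      rw [← mul_assoc, ← pow_succ, ← e2_nat_mul, ← e2_add, e2_eq_one_iff] at hn
      obtain ⟨k, hk⟩ := hn
      exact ⟨-k, n + 1, by push_cast at hk ⊢; linear_combination -hk⟩

lemma apply_add_int_mul_of_periodic {G : ℂ → ℂ} {τ : ℂ} (h1 : ∀ z, G (z + 1) = G z)
    (hτ : ∀ z, G (z + τ) = G z) (a b : ℤ) (z : ℂ) : G (z + (a + b * τ)) = G z := by
  have h1' : Function.Periodic G 1 := h1
  have hτ' : Function.Periodic G τ := hτ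
  have := (h1'.int_mul a).add_period (hτ'.int_mul b) z
  simpa using this

/-- An entire doubly periodic function is constant. -/
lemma eq_apply_zero_of_doubly_periodic {G : ℂ → ℂ} {τ : ℂ} (hτ : 0 < τ.im)
    (hG : Differentiable ℂ G) (h1 : ∀ z, G (z + 1) = G z) (h2 : ∀ z, G (z + τ) = G z) (z : ℂ) :
    G z = G 0 := by
  refine hG.apply_eq_apply_of_bounded ?_ z 0
  have hK : IsCompact ((fun p : ℝ × ℝ => (p.1 : ℂ) + p.2 * τ) '' (Set.Icc 0 1 ×ˢ Set.Icc 0 1)) :=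
    (isCompact_Icc.prod isCompact_Icc).image (by fun_prop)
  refine (hK.image hG.continuous).isBounded.subset ?_
  rintro _ ⟨w, rfl⟩
  set y : ℝ := w.im / τ.im with hy
  set x : ℝ := w.re - y * τ.re with hx
  have hw : w = x + y * τ := by
    apply Complex.ext <;> simp [hx, hy]
    field_simp
  refine ⟨_, ⟨(Int.fract x, Int.fract y), ⟨⟨Int.fract_nonneg _, (Int.fract_lt_one _).le⟩,
    ⟨Int.fract_nonneg _, (Int.fract_lt_one _).le⟩⟩, rfl⟩, ?_⟩
  rw [← apply_add_int_mul_of_periodic h1 h2 ⌊x⌋ ⌊y⌋]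
  congr 1
  conv_rhs => rw [hw, ← Int.floor_add_fract x, ← Int.floor_add_fract y]
  push_cast
  ring

/-- A theta function of degree `2m ≠ 0` which vanishes at the origin to order greater than `2m`
is zero. -/
lemma eq_zero_of_quasiperiodic {τ : ℂ} (hτ : 0 < τ.im) {m : ℕ} (hm : m ≠ 0) {f g : ℂ → ℂ}
    (hf : Differentiable ℂ f) (hg : Differentiable ℂ g) (hfg : ∀ z, f z = z ^ (2 * m + 1) * g z)
    (h1 : ∀ z, f (z + 1) = f z) (h2 : ∀ z, f (z + τ) = e2 (-m * (τ + 2 * z)) * f z) (z : ℂ) :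
    f z = 0 := by
  obtain ⟨P, Q, hP, hQ, hQ0, hPQ, hP1, hP2, hP0⟩ := exists_thetaProduct hτ
  have he := differentiable_e2
  set G : ℂ → ℂ := fun z => f z * e2 z ^ m / P z ^ (2 * m) with hGdef
  have hG1 : ∀ z, G (z + 1) = G z := fun z => by
    have : e2 (z + 1) = e2 z := by
      rw [e2_add]; simpa using congrArg (e2 z * ·) (e2_intCast 1)
    simp [hGdef, h1, hP1, this]
  have hG2 : ∀ z, G (z + τ) = G z := fun z => by
    have h3 : e2 (-m * (τ + 2 * z)) = (e2 τ ^ m)⁻¹ * (e2 z ^ (2 * m))⁻¹ := by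
      rw [← e2_nat_mul, ← e2_nat_mul, ← e2_neg, ← e2_neg, ← e2_add]; congr 1; push_cast; ring
    simp only [hGdef]
    rw [h2, hP2 z, h3, e2_add, mul_pow (-e2 z), (even_two_mul m).neg_pow]
    have := e2_ne_zero z
    have := e2_ne_zero τ
    field_simp
    rw [mul_pow]
    ring
  have hG0 : ∀ᶠ z in nhds 0, G z = z * g z * e2 z ^ m / (dslope e2 0 z * Q z) ^ (2 * m) := by
    refine Filter.Eventually.of_forall fun z => ?_
    rcases eq_or_ne z 0 with rfl | hz
    · simp [hGdef, hPQ, e2_zero, hm]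
    have h4 : 1 - e2 z = -(z * dslope e2 0 z) := by
      have := sub_smul_dslope e2 0 z
      simp only [sub_zero, smul_eq_mul, e2_zero] at this
      rw [this]; ring
    simp only [hGdef]
    rw [hfg, hPQ, h4, neg_mul, (even_two_mul m).neg_pow, mul_assoc z (dslope e2 0 z), mul_pow z]
    rw [show z ^ (2 * m + 1) * g z * e2 z ^ m = z ^ (2 * m) * (z * g z * e2 z ^ m) by ring]
    rw [mul_div_mul_left _ _ (pow_ne_zero _ hz)]
  have hd0 : DifferentiableAt ℂ G 0 := by
    refine DifferentiableAt.congr_of_eventuallyEq ?_ hG0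
    have hds : Differentiable ℂ (dslope e2 0) := by
      rw [← differentiableOn_univ, Complex.differentiableOn_dslope Filter.univ_mem]
      exact he.differentiableOn
    refine DifferentiableAt.div (by fun_prop) (by fun_prop) ?_
    refine pow_ne_zero _ (mul_ne_zero ?_ hQ0)
    rw [dslope_same]
    have : HasDerivAt e2 (Complex.exp (2 * Real.pi * Complex.I * 0) * (2 * Real.pi * Complex.I * 1)) 0 :=
      ((hasDerivAt_id (0 : ℂ)).const_mul (2 * (Real.pi : ℂ) * Complex.I)).cexp
    rw [this.deriv]
    simp [Real.pi_ne_zero]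
  have hG : Differentiable ℂ G := fun w => by
    by_cases hw : P w = 0
    · obtain ⟨a, b, hab⟩ := hP0 w hw
      have h5 : G = fun z => G (z + ((-a : ℤ) + (-b : ℤ) * τ)) :=
        funext fun z => (apply_add_int_mul_of_periodic hG1 hG2 _ _ z).symm
      have h6 : w + ((-a : ℤ) + (-b : ℤ) * τ) = 0 := by rw [hab]; push_cast; ring
      rw [h5, differentiableAt_comp_add_const, h6]
      exact hd0
    · exact DifferentiableAt.div (by fun_prop) (by fun_prop) (pow_ne_zero _ hw)
  have hGz : ∀ z, G z = 0 := fun z => by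
    rw [eq_apply_zero_of_doubly_periodic hτ hG hG1 hG2, hG0.self_of_nhds]; simp
  have hPf : ∀ z, P z * f z = 0 := fun z => by
    by_contra h
    obtain ⟨h7, h8⟩ := mul_ne_zero_iff.mp h
    exact div_ne_zero (mul_ne_zero h8 (pow_ne_zero m (e2_ne_zero z))) (pow_ne_zero (2 * m) h7)
      (hGz z)
  have hPne : ∃ w, P w ≠ 0 := by
    refine ⟨τ / 2, fun h => ?_⟩
    obtain ⟨a, b, hab⟩ := hP0 _ h
    have h9 := congrArg Complex.im hab
    have : (1 : ℝ) / 2 = b := by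
      simp at h9
      field_simp at h9 ⊢
      linarith
    have h10 : (1 : ℝ) = (2 * b : ℤ) := by push_cast; linarith
    norm_cast at h10
    omega
  have hor := AnalyticOnNhd.eq_zero_or_eq_zero_of_mul_eq_zero (U := Set.univ) (f := P) (g := f)
    (fun z _ => hP.analyticAt z) (fun z _ => hf.analyticAt z) (fun z _ => hPf z)
    isPreconnected_univ
  rcases hor with h | h
  · exact absurd (h _ (Set.mem_univ _)) hPne.choose_spec
  · exact h z (Set.mem_univ z)

/-! ### Cusp forms of small weight -/

open UpperHalfPlane ModularForm MatrixGroups in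
/-- There are no nonzero cusp forms of level one and weight less than `12`. -/
lemma eq_zero_of_cuspidal {k : ℤ} (hk : k < 12) {a : ℂ → ℂ}
    (ha : DifferentiableOn ℂ a {τ | 0 < τ.im}) (hT : ∀ τ, 0 < τ.im → a (τ + 1) = a τ)
    (hS : ∀ τ, 0 < τ.im → a (-1 / τ) = τ ^ k * a τ)
    (h0 : ∀ ε > 0, ∃ A, ∀ τ : ℂ, 0 < τ.im → A ≤ τ.im → ‖a τ‖ ≤ ε) {τ : ℂ} (hτ : 0 < τ.im) :
    a τ = 0 := by
  set F : ℍ → ℂ := fun τ => a τ with hF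
  have hFT : F ∣[k] ModularGroup.T = F := by
    ext z
    rw [SL_slash_apply, modular_T_smul]
    have h1 : ((1 : ℝ) +ᵥ z : ℍ) = (z : ℂ) + 1 := by rw [coe_vadd, add_comm]; simp
    have h2 : denom (ModularGroup.T : SL(2, ℤ)) z = 1 := by
      simp [ModularGroup.denom_apply, ModularGroup.coe_T]
    rw [h2]
    simp only [hF]
    rw [h1, hT _ z.2, one_zpow, mul_one]
  have hFS : F ∣[k] ModularGroup.S = F := by
    ext z
    rw [SL_slash_apply, modular_S_smul]
    have h1 : (-(z : ℂ))⁻¹ = -1 / z := by rw [inv_neg, neg_div, one_div]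
    simp only [hF, ModularGroup.denom_S]
    rw [coe_mk, h1, hS _ z.2, mul_comm, ← mul_assoc, ← zpow_add₀ z.ne_zero]
    simp
  have hF0 : IsZeroAtImInfty F := by
    rw [isZeroAtImInfty_iff]
    intro ε hε
    obtain ⟨A, hA⟩ := h0 ε hε
    exact ⟨A, fun z hz => hA z z.2 hz⟩
  let f : CuspForm 𝒮ℒ k :=
    { toFun := F
      slash_action_eq' := by
        rintro A ⟨A, rfl⟩
        exact SlashInvariantForm.slash_action_generators_SL2Z hFS hFT A
      holo' := by
        rw [UpperHalfPlane.mdifferentiable_iff]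
        refine ha.congr fun z hz => ?_
        simp [hF, ofComplex_apply_of_im_pos hz]
      zero_at_cusps' := by
        intro c hc
        rw [Subgroup.IsArithmetic.isCusp_iff_isCusp_SL2Z] at hc
        rw [OnePoint.isZeroAt_iff_forall_SL2Z hc]
        intro γ _
        rw [SlashInvariantForm.slash_action_generators_SL2Z hFS hFT]
        exact hF0 }
  have hf : f = 0 := rank_zero_iff_forall_zero.mp (CuspForm.rank_eq_zero_of_weight_lt_twelve hk) f
  exact congrArg (fun g : CuspForm 𝒮ℒ k => g ⟨τ, hτ⟩) hf

/-! ### Uniqueness of Jacobi forms of small weight -/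

/-- Approach to the cusp `i∞` of `ℍ × ℂ`, with bounded `re τ` and `z`. -/
def cuspFilter : Filter (ℂ × ℂ) :=
  Filter.comap (fun p : ℂ × ℂ => p.1.im) Filter.atTop ⊓
    Filter.principal {p | |p.1.re| ≤ 1 ∧ ‖p.2‖ ≤ 1}

lemma eventually_cuspFilter {P : ℂ × ℂ → Prop} :
    (∀ᶠ p in cuspFilter, P p) ↔
      ∃ A : ℝ, ∀ τ z : ℂ, A ≤ τ.im → |τ.re| ≤ 1 → ‖z‖ ≤ 1 → P (τ, z) := by
  rw [cuspFilter, Filter.eventually_inf_principal, Filter.eventually_comap,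
    Filter.eventually_atTop]
  constructor
  · rintro ⟨A, hA⟩
    exact ⟨A, fun τ z h1 h2 h3 => hA _ h1 (τ, z) rfl ⟨h2, h3⟩⟩
  · rintro ⟨A, hA⟩
    exact ⟨A, fun b hb p hp h => hA p.1 p.2 (hp ▸ hb) h.1 h.2⟩

/-- Functions on `ℍ × ℂ` which transform like a Jacobi form of weight `k` and index `m`, and tend
to `c` at the cusp. -/
structure JacobiLike (k m : ℕ) (c : ℂ) (φ : ℂ → ℂ → ℂ) : Prop where
  diff_z : ∀ τ, 0 < τ.im → Differentiable ℂ (φ τ)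
  diff_τ : ∀ z, DifferentiableOn ℂ (fun τ => φ τ z) {τ | 0 < τ.im}
  bdd : ∀ τ₀ : ℂ, 0 < τ₀.im → ∃ M : ℝ, ∀ᶠ τ in nhds τ₀, ∀ z, ‖z‖ ≤ 1 → ‖φ τ z‖ ≤ M
  cusp : Filter.Tendsto (fun p : ℂ × ℂ => φ p.1 p.2) cuspFilter (nhds c)
  map_T : ∀ τ z, 0 < τ.im → φ (τ + 1) z = φ τ z
  map_S : ∀ τ z, 0 < τ.im → φ (-1 / τ) (z / τ) = τ ^ k * e2 (m * (z ^ 2 / τ)) * φ τ z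
  map_add_one : ∀ τ z, 0 < τ.im → φ τ (z + 1) = φ τ z
  map_add_self : ∀ τ z, 0 < τ.im → φ τ (z + τ) = e2 (-m * (τ + 2 * z)) * φ τ z

lemma JacobiLike.sub {k m : ℕ} {c c' : ℂ} {φ ψ : ℂ → ℂ → ℂ} (h : JacobiLike k m c φ)
    (h' : JacobiLike k m c' ψ) : JacobiLike k m (c - c') (fun τ z => φ τ z - ψ τ z) where
  diff_z τ hτ := (h.diff_z τ hτ).sub (h'.diff_z τ hτ)
  diff_τ z := (h.diff_τ z).sub (h'.diff_τ z)
  bdd τ₀ hτ₀ := by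
    obtain ⟨M, hM⟩ := h.bdd τ₀ hτ₀
    obtain ⟨M', hM'⟩ := h'.bdd τ₀ hτ₀
    refine ⟨M + M', ?_⟩
    filter_upwards [hM, hM'] with τ h1 h2 z hz
    exact (norm_sub_le _ _).trans (add_le_add (h1 z hz) (h2 z hz))
  cusp := h.cusp.sub h'.cusp
  map_T τ z hτ := by rw [h.map_T τ z hτ, h'.map_T τ z hτ]
  map_S τ z hτ := by rw [h.map_S τ z hτ, h'.map_S τ z hτ, mul_sub]
  map_add_one τ z hτ := by rw [h.map_add_one τ z hτ, h'.map_add_one τ z hτ]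
  map_add_self τ z hτ := by rw [h.map_add_self τ z hτ, h'.map_add_self τ z hτ, mul_sub]

lemma norm_le_of_pow_mul_le {f g : ℂ → ℂ} {n : ℕ} {M : ℝ} (hg : Differentiable ℂ g)
    (hfg : ∀ z, f z = z ^ n * g z) (hM : ∀ z, ‖z‖ ≤ 1 → ‖f z‖ ≤ M) {z : ℂ} (hz : ‖z‖ ≤ 1) :
    ‖g z‖ ≤ M := by
  refine Complex.norm_le_of_forall_mem_frontier_norm_le (U := Metric.ball 0 1)
    Metric.isBounded_ball hg.diffContOnCl (fun w hw => ?_)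
    (by rw [closure_ball _ one_ne_zero]; simpa using hz)
  rw [frontier_ball _ one_ne_zero, mem_sphere_zero_iff_norm] at hw
  simpa [hfg, hw] using hM w hw.le

lemma norm_sub_apply_zero_le {g : ℂ → ℂ} {M : ℝ} (hg : Differentiable ℂ g)
    (hM : ∀ z, ‖z‖ ≤ 1 → ‖g z‖ ≤ M) {z : ℂ} (hz : ‖z‖ < 1) :
    ‖g z - g 0‖ ≤ (2 * M + 1) * ‖z‖ := by
  have h := Complex.dist_le_div_mul_dist_of_mapsTo_ball (f := g) (c := 0) (z := z) (R₁ := 1)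
    (R₂ := 2 * M + 1) hg.differentiableOn (fun w hw => ?_) (by simpa using hz)
  · simpa [dist_eq_norm] using h
  · rw [mem_ball_zero_iff] at hw
    rw [Metric.mem_closedBall, dist_eq_norm]
    have := norm_sub_le (g w) (g 0)
    have := hM w hw.le
    have := hM 0 (by simp)
    linarith

/-- The first nonzero Taylor coefficient of a Jacobi form which vanishes at the cusp is a cusp
form. -/
lemma JacobiLike.taylor_succ {k m n : ℕ} {φ : ℂ → ℂ → ℂ} (h : JacobiLike k m 0 φ)
    (hkn : k + n < 12)
    (hn : ∀ τ, 0 < τ.im → ∃ g : ℂ → ℂ, Differentiable ℂ g ∧ ∀ z, φ τ z = z ^ n * g z) {τ : ℂ}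
    (hτ : 0 < τ.im) : ∃ g : ℂ → ℂ, Differentiable ℂ g ∧ ∀ z, φ τ z = z ^ (n + 1) * g z := by
  choose! g hg hφ using hn
  have hext : ∀ {f₁ f₂ : ℂ → ℂ}, Continuous f₁ → Continuous f₂ → (∀ z, z ≠ 0 → f₁ z = f₂ z) →
      f₁ 0 = f₂ 0 := fun h₁ h₂ h₃ =>
    congrFun (h₁.ext_on (dense_compl_singleton 0) h₂ fun z hz => h₃ z hz) 0
  have hT : ∀ τ, 0 < τ.im → g (τ + 1) 0 = g τ 0 := fun τ hτ => by
    have h1 : 0 < (τ + 1).im := by simpa using hτ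
    refine hext (hg _ h1).continuous (hg _ hτ).continuous fun z hz => ?_
    have h2 := h.map_T τ z hτ
    rw [hφ _ h1, hφ _ hτ] at h2
    exact mul_left_cancel₀ (pow_ne_zero n hz) h2
  have hS : ∀ τ, 0 < τ.im → g (-1 / τ) 0 = τ ^ ((k + n : ℕ) : ℤ) * g τ 0 := fun τ hτ => by
    have hτ0 : τ ≠ 0 := fun h0 => by simp [h0] at hτ
    have h1 : 0 < (-1 / τ).im := by
      rw [neg_div, one_div, neg_im, inv_im, neg_div, neg_neg]
      exact div_pos hτ (normSq_pos.mpr hτ0)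
    have h3 := hext (f₁ := fun z => g (-1 / τ) (z / τ))
      (f₂ := fun z => τ ^ (k + n) * e2 (m * (z ^ 2 / τ)) * g τ z)
      ((hg _ h1).continuous.comp (by fun_prop))
      ((continuous_const.mul (differentiable_e2.continuous.comp (by fun_prop))).mul
        (hg _ hτ).continuous) fun z hz => by
      have h2 := h.map_S τ z hτ
      rw [hφ _ h1, hφ _ hτ, div_pow, div_mul_eq_mul_div, div_eq_iff (pow_ne_zero n hτ0)] at h2
      refine mul_left_cancel₀ (pow_ne_zero n hz) ?_
      linear_combination h2
    rw [zpow_natCast]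
    simpa [e2_zero] using h3
  have h0 : ∀ ε > 0, ∃ A, ∀ τ : ℂ, 0 < τ.im → A ≤ τ.im → ‖g τ 0‖ ≤ ε := fun ε hε => by
    obtain ⟨A, hA⟩ := eventually_cuspFilter.mp (h.cusp.eventually (Metric.closedBall_mem_nhds 0 hε))
    have key : ∀ τ : ℂ, 0 < τ.im → A ≤ τ.im → |τ.re| ≤ 1 → ‖g τ 0‖ ≤ ε := fun τ hτ h1 h2 =>
      norm_le_of_pow_mul_le (hg τ hτ) (hφ τ hτ)
        (fun z hz => by simpa using hA τ z h1 h2 hz) (by simp)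
    refine ⟨A, fun τ hτ h1 => ?_⟩
    have hper : ∀ j : ℕ, ∀ τ, 0 < τ.im → g (τ + j) 0 = g τ 0 := fun j => by
      induction j with
      | zero => simp
      | succ j ih =>
        intro τ hτ
        rw [Nat.cast_succ, ← add_assoc, hT _ (by simpa using hτ), ih τ hτ]
    obtain ⟨w, hw, hw1, hw2⟩ : ∃ w : ℂ, w.im = τ.im ∧ |w.re| ≤ 1 ∧ g w 0 = g τ 0 := by
      have hf := Int.fract_nonneg τ.re
      have hf' := (Int.fract_lt_one τ.re).le
      refine ⟨τ - ⌊τ.re⌋, by simp, ?_, ?_⟩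
      · simpa [abs_le] using ⟨by linarith, hf'⟩
      · obtain ⟨j, hj | hj⟩ := Int.eq_nat_or_neg ⌊τ.re⌋
        · rw [← hper j (τ - ⌊τ.re⌋) (by simpa using hτ), hj]; simp
        · rw [hj]; simpa using hper j τ hτ
    rw [← hw2]
    exact key w (hw ▸ hτ) (hw ▸ h1) hw1
  have ha : DifferentiableOn ℂ (fun τ => g τ 0) {τ | 0 < τ.im} := by
    have hopen : IsOpen {τ : ℂ | 0 < τ.im} := isOpen_lt continuous_const continuous_im
    have hu : Filter.Tendsto (fun j : ℕ => ((1 : ℝ) / ((j : ℝ) + 1))) Filter.atTop (nhds 0) :=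
      tendsto_one_div_add_atTop_nhds_zero_nat
    refine TendstoLocallyUniformlyOn.differentiableOn (φ := Filter.atTop)
      (F := fun (j : ℕ) τ => g τ ((1 / ((j : ℝ) + 1) : ℝ) : ℂ)) ?_ (.of_forall fun j => ?_) hopen
    · rw [Metric.tendstoLocallyUniformlyOn_iff]
      intro ε hε τ₀ hτ₀
      obtain ⟨M, hM⟩ := h.bdd τ₀ hτ₀
      refine ⟨{τ | 0 < τ.im} ∩ {τ | ∀ z, ‖z‖ ≤ 1 → ‖φ τ z‖ ≤ M},
        Filter.inter_mem self_mem_nhdsWithin (mem_nhdsWithin_of_mem_nhds hM), ?_⟩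
      have hu' := hu.const_mul (2 * M + 1)
      rw [mul_zero] at hu'
      filter_upwards [hu'.eventually (gt_mem_nhds hε), hu.eventually (gt_mem_nhds one_pos)]
        with j hj hj1 τ hτ
      have hpos : (0 : ℝ) ≤ 1 / ((j : ℝ) + 1) := by positivity
      have hnorm : ‖((1 / ((j : ℝ) + 1) : ℝ) : ℂ)‖ = 1 / ((j : ℝ) + 1) := by
        rw [norm_real, Real.norm_of_nonneg hpos]
      rw [dist_comm, dist_eq_norm]
      refine lt_of_le_of_lt ?_ hj
      refine (norm_sub_apply_zero_le (hg τ hτ.1)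
        (fun z hz => norm_le_of_pow_mul_le (hg τ hτ.1) (hφ τ hτ.1) hτ.2 hz)
        (by rwa [hnorm])).trans_eq ?_
      rw [hnorm]
    · set u : ℂ := ((1 / ((j : ℝ) + 1) : ℝ) : ℂ)
      have hu0 : u ≠ 0 := by
        simp only [u, ne_eq, ofReal_eq_zero]
        positivity
      refine ((h.diff_τ u).mul_const ((u ^ n)⁻¹)).congr fun τ hτ => ?_
      rw [hφ τ hτ]
      field_simp
  have hz : g τ 0 = 0 := eq_zero_of_cuspidal (by exact_mod_cast hkn) ha hT hS h0 hτ
  refine ⟨dslope (g τ) 0, ?_, fun z => ?_⟩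
  · rw [← differentiableOn_univ, Complex.differentiableOn_dslope Filter.univ_mem]
    exact (hg τ hτ).differentiableOn
  · have := sub_smul_dslope (g τ) 0 z
    rw [sub_zero, hz, sub_zero, smul_eq_mul] at this
    rw [hφ τ hτ, pow_succ, mul_assoc, this]

/-- A Jacobi form of index `m ≠ 0` and weight `k < 12 - 2m` which vanishes at the cusp is zero. -/
lemma JacobiLike.eq_zero {k m : ℕ} {φ : ℂ → ℂ → ℂ} (h : JacobiLike k m 0 φ) (hm : m ≠ 0)
    (hkm : k + 2 * m < 12) {τ : ℂ} (hτ : 0 < τ.im) (z : ℂ) : φ τ z = 0 := by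
  have key : ∀ n ≤ 2 * m + 1, ∀ τ, 0 < τ.im →
      ∃ g : ℂ → ℂ, Differentiable ℂ g ∧ ∀ z, φ τ z = z ^ n * g z := by
    intro n
    induction n with
    | zero => exact fun _ τ hτ => ⟨φ τ, h.diff_z τ hτ, by simp⟩
    | succ n ih => exact fun hn τ hτ => h.taylor_succ (by omega) (ih (by omega)) hτ
  obtain ⟨g, hg, hφ⟩ := key _ le_rfl τ hτ
  exact eq_zero_of_quasiperiodic hτ hm (h.diff_z τ hτ) hg hφ (fun z => h.map_add_one τ z hτ)
    (fun z => h.map_add_self τ z hτ) z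

/-! ### Transformation laws of the Jacobi–Eisenstein series -/

/-- The exponent in the summand of the Jacobi–Eisenstein series attached to `(a b; c d)`. -/
def eisExponent (τ z : ℂ) (a b c d l : ℤ) : ℂ :=
  (l : ℂ) ^ 2 * ((a : ℂ) * τ + (b : ℂ)) / ((c : ℂ) * τ + (d : ℂ)) +
    2 * (l : ℂ) * z / ((c : ℂ) * τ + (d : ℂ)) - (c : ℂ) * z ^ 2 / ((c : ℂ) * τ + (d : ℂ))

lemma bezout_spec {c d : ℤ} (h : IsCoprime c d) :
    (bezout c d).1 * d - (bezout c d).2 * c = 1 := by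
  have h' : ∃ ab : ℤ × ℤ, ab.1 * d - ab.2 * c = 1 := by
    obtain ⟨x, y, hxy⟩ := h
    exact ⟨(y, -x), by linear_combination hxy⟩
  rw [bezout, dif_pos h']
  exact h'.choose_spec

lemma linear_ne_zero {τ : ℂ} (hτ : 0 < τ.im) {a b c d : ℤ} (h : a * d - b * c = 1) :
    (c : ℂ) * τ + d ≠ 0 := by
  intro h0
  have h1 := congrArg Complex.im h0
  simp [hτ.ne'] at h1
  subst h1
  simp at h0
  subst h0
  simp at h

lemma e2_mul_natCast_add_intCast (m : ℕ) (x : ℂ) (n : ℤ) : e2 (m * (x + n)) = e2 (m * x) := by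
  rw [mul_add, e2_add]
  have := e2_intCast (m * n)
  push_cast at this
  rw [this, mul_one]

/-- The summand of the Jacobi–Eisenstein series does not depend on the choice of `(a, b)`. -/
lemma EisJSummand_eq (k m : ℕ) {τ : ℂ} (hτ : 0 < τ.im) (z : ℂ) {a b c d : ℤ}
    (h : a * d - b * c = 1) : EisJSummand k m τ z c d =
      ((c : ℂ) * τ + d) ^ (-(k : ℤ)) * ∑' l : ℤ, e2 (m * eisExponent τ z a b c d l) := by
  have h' := bezout_spec (c := c) (d := d) ⟨-b, a, by linear_combination h⟩
  rw [EisJSummand]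
  congr 1
  refine tsum_congr fun l => ?_
  obtain ⟨x, hx⟩ : ∃ x : ℤ, x = a * (bezout c d).2 - (bezout c d).1 * b := ⟨_, rfl⟩
  have h1 : (bezout c d).1 = a + x * c := by
    rw [hx]; linear_combination -(bezout c d).1 * h + a * h'
  have h2 : (bezout c d).2 = b + x * d := by
    rw [hx]; linear_combination -(bezout c d).2 * h + b * h'
  rw [← e2_mul_natCast_add_intCast m (eisExponent τ z a b c d l) (l ^ 2 * x), h1, h2, eisExponent]
  have := linear_ne_zero hτ h
  congr 2
  push_cast
  field_simp
  ring

lemma EisJSummand_map_T (k m : ℕ) {τ : ℂ} (hτ : 0 < τ.im) (z : ℂ) {c d : ℤ} (h : IsCoprime c d) :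
    EisJSummand k m (τ + 1) z c d = EisJSummand k m τ z c (c + d) := by
  have h1 := bezout_spec h
  set a := (bezout c d).1
  set b := (bezout c d).2
  rw [EisJSummand_eq k m (by simpa using hτ) z h1, EisJSummand_eq k m hτ z (a := a) (b := a + b)
    (by linear_combination h1)]
  have h2 : (c : ℂ) * (τ + 1) + d = c * τ + (c + d : ℤ) := by push_cast; ring
  have h3 : (a : ℂ) * (τ + 1) + b = a * τ + (a + b : ℤ) := by push_cast; ring
  simp only [eisExponent, h2, h3]

lemma neg_one_div_im_pos {τ : ℂ} (hτ : 0 < τ.im) : 0 < (-1 / τ).im := by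
  rw [neg_div, one_div, neg_im, inv_im, neg_div, neg_neg]
  exact div_pos hτ (normSq_pos.mpr fun h0 => by simp [h0] at hτ)

lemma EisJSummand_map_S (k m : ℕ) {τ : ℂ} (hτ : 0 < τ.im) (z : ℂ) {c d : ℤ} (h : IsCoprime c d) :
    EisJSummand k m (-1 / τ) (z / τ) c d =
      τ ^ k * e2 (m * (z ^ 2 / τ)) * EisJSummand k m τ z d (-c) := by
  have h1 := bezout_spec h
  set a := (bezout c d).1
  set b := (bezout c d).2
  have h2 : b * -c - -a * d = 1 := by linear_combination h1
  have hτ0 : τ ≠ 0 := fun h0 => by simp [h0] at hτ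
  rw [EisJSummand_eq k m (neg_one_div_im_pos hτ) _ h1, EisJSummand_eq k m hτ z h2]
  have h3 := linear_ne_zero hτ h2
  have h4 : (c : ℂ) * (-1 / τ) + d = (d * τ + (-c : ℤ)) / τ := by push_cast; field_simp; ring
  have h5 : ∀ l, e2 (m * eisExponent (-1 / τ) (z / τ) a b c d l) =
      e2 (m * (z ^ 2 / τ)) * e2 (m * eisExponent τ z b (-a) d (-c) l) := fun l => by
    rw [← e2_add, ← mul_add, eisExponent, eisExponent, h4]
    obtain ⟨j, hj⟩ : ∃ j : ℂ, j = d * τ + (-c : ℤ) := ⟨_, rfl⟩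
    have hc : (c : ℂ) = d * τ - j := by rw [hj]; push_cast; ring
    rw [← hj] at h3 ⊢
    rw [hc]
    push_cast
    congr 2
    field_simp
    ring
  simp only [h5]
  rw [tsum_mul_left, h4, div_zpow, zpow_neg τ, zpow_natCast]
  have := pow_ne_zero k hτ0
  field_simp

lemma EisJSummand_add_one (k m : ℕ) {τ : ℂ} (hτ : 0 < τ.im) (z : ℂ) {c d : ℤ}
    (h : IsCoprime c d) : EisJSummand k m τ (z + 1) c d = EisJSummand k m τ z c d := by
  have h1 := bezout_spec h
  have h3 := linear_ne_zero hτ h1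
  rw [EisJSummand_eq k m hτ _ h1, EisJSummand_eq k m hτ z h1]
  set a := (bezout c d).1
  set b := (bezout c d).2
  congr 1
  rw [← (Equiv.addRight c).tsum_eq]
  refine tsum_congr fun l => ?_
  rw [← e2_mul_natCast_add_intCast m (eisExponent τ z a b c d l) ((2 * l + c) * a), eisExponent, eisExponent]
  congr 2
  have h4 : (a : ℂ) * d - b * c = 1 := by exact_mod_cast h1
  simp only [Equiv.coe_addRight]
  push_cast
  field_simp
  linear_combination (-(2 * l + c) : ℂ) * h4

lemma EisJSummand_add_self (k m : ℕ) {τ : ℂ} (hτ : 0 < τ.im) (z : ℂ) {c d : ℤ}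
    (h : IsCoprime c d) :
    EisJSummand k m τ (z + τ) c d = e2 (-m * (τ + 2 * z)) * EisJSummand k m τ z c d := by
  have h1 := bezout_spec h
  have h3 := linear_ne_zero hτ h1
  rw [EisJSummand_eq k m hτ _ h1, EisJSummand_eq k m hτ z h1]
  set a := (bezout c d).1
  set b := (bezout c d).2
  rw [mul_left_comm]
  congr 1
  rw [← tsum_mul_left, ← (Equiv.subRight d).tsum_eq]
  refine tsum_congr fun l => ?_
  rw [← e2_mul_natCast_add_intCast m (eisExponent τ z a b c d l) ((d - 2 * l) * b), ← e2_add,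
    eisExponent, eisExponent]
  have h4 : (a : ℂ) * d - b * c = 1 := by exact_mod_cast h1
  congr 1
  rw [neg_mul, ← mul_neg, ← mul_add]
  congr 1
  simp only [Equiv.subRight_apply]
  push_cast
  simp only [div_eq_mul_inv]
  linear_combination (d - 2 * l : ℂ) * τ * ((c : ℂ) * τ + d)⁻¹ * h4 +
    ((d - 2 * l) * b - τ - 2 * z) * mul_inv_cancel₀ h3

lemma EisJ_map_T (k m : ℕ) {τ : ℂ} (hτ : 0 < τ.im) (z : ℂ) :
    EisJ k m (τ + 1) z = EisJ k m τ z := by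
  rw [EisJ, EisJ]
  congr 1
  let e : {p : ℤ × ℤ // IsCoprime p.1 p.2} ≃ {p : ℤ × ℤ // IsCoprime p.1 p.2} :=
    { toFun := fun p => ⟨(p.1.1, p.1.1 + p.1.2), by
        simpa [add_comm] using (IsCoprime.add_mul_left_right_iff (z := 1)).mpr p.2⟩
      invFun := fun p => ⟨(p.1.1, p.1.2 - p.1.1), by
        simpa [sub_eq_add_neg] using (IsCoprime.add_mul_left_right_iff (z := -1)).mpr p.2⟩
      left_inv := fun p => by simp
      right_inv := fun p => by simp }
  rw [← e.tsum_eq fun p => EisJSummand k m τ z p.1.1 p.1.2]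
  exact tsum_congr fun p => EisJSummand_map_T k m hτ z p.2

lemma EisJ_map_S (k m : ℕ) {τ : ℂ} (hτ : 0 < τ.im) (z : ℂ) :
    EisJ k m (-1 / τ) (z / τ) = τ ^ k * e2 (m * (z ^ 2 / τ)) * EisJ k m τ z := by
  rw [EisJ, EisJ, mul_left_comm (_ * _)]
  congr 1
  rw [← tsum_mul_left]
  let e : {p : ℤ × ℤ // IsCoprime p.1 p.2} ≃ {p : ℤ × ℤ // IsCoprime p.1 p.2} :=
    { toFun := fun p => ⟨(p.1.2, -p.1.1), p.2.symm.neg_right⟩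
      invFun := fun p => ⟨(-p.1.2, p.1.1), p.2.symm.neg_left⟩
      left_inv := fun p => by simp
      right_inv := fun p => by simp }
  rw [← e.tsum_eq fun p => _ * EisJSummand k m τ z p.1.1 p.1.2]
  exact tsum_congr fun p => EisJSummand_map_S k m hτ z p.2

lemma EisJ_add_one (k m : ℕ) {τ : ℂ} (hτ : 0 < τ.im) (z : ℂ) :
    EisJ k m τ (z + 1) = EisJ k m τ z := by
  rw [EisJ, EisJ]
  congr 1
  exact tsum_congr fun p => EisJSummand_add_one k m hτ z p.2

lemma EisJ_add_self (k m : ℕ) {τ : ℂ} (hτ : 0 < τ.im) (z : ℂ) :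
    EisJ k m τ (z + τ) = e2 (-m * (τ + 2 * z)) * EisJ k m τ z := by
  rw [EisJ, EisJ, mul_left_comm]
  congr 1
  rw [← tsum_mul_left]
  exact tsum_congr fun p => EisJSummand_add_self k m hτ z p.2

/-! ### Analytic properties of the Jacobi–Eisenstein series -/

/-- The terms of the Jacobi–Eisenstein series as a double series. -/
def eisTerm (k m : ℕ) (τ z : ℂ) (i : {p : ℤ × ℤ // IsCoprime p.1 p.2} × ℤ) : ℂ :=
  ((i.1.1.1 : ℂ) * τ + i.1.1.2) ^ (-(k : ℤ)) *
    e2 (m * eisExponent τ z (bezout i.1.1.1 i.1.1.2).1 (bezout i.1.1.1 i.1.1.2).2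
      i.1.1.1 i.1.1.2 i.2)

lemma le_im_eisExponent {τ : ℂ} (hτ : 0 < τ.im) (z : ℂ) {a b c d : ℤ} (h : a * d - b * c = 1)
    (l : ℤ) : τ.im / 2 * (|(l : ℝ)| / ‖(c : ℂ) * τ + d‖) ^ 2 - 3 * (‖z‖ ^ 2 / τ.im) ≤
      (eisExponent τ z a b c d l).im := by
  have hj := linear_ne_zero hτ h
  set j := (c : ℂ) * τ + d with hjdef
  have hJ : 0 < ‖j‖ := norm_pos_iff.mpr hj
  have hcJ : |(c : ℝ)| * τ.im ≤ ‖j‖ := by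
    have := Complex.abs_im_le_norm j
    rwa [hjdef, show ((c : ℂ) * τ + d).im = c * τ.im by simp, abs_mul, abs_of_pos hτ] at this
  have h1 : ((l : ℂ) ^ 2 * (a * τ + b) / j).im = τ.im * (|(l : ℝ)| / ‖j‖) ^ 2 := by
    have hN : ‖j‖ ^ 2 = normSq j := (Complex.normSq_eq_norm_sq j).symm
    have hN0 : normSq j ≠ 0 := hN ▸ (pow_pos hJ 2).ne'
    have hd : (a : ℝ) * d - b * c = 1 := by exact_mod_cast h
    have h3 : ((a : ℂ) * τ + b) / j = (a * τ + b) * (starRingEnd ℂ) j / (normSq j : ℝ) := by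
      rw [Complex.normSq_eq_conj_mul_self, mul_comm ((starRingEnd ℂ) j), mul_div_mul_right]
      exact (map_ne_zero _).mpr hj
    rw [div_pow, sq_abs, hN, mul_div_assoc, h3, ← mul_div_assoc, Complex.div_ofReal_im,
      ← mul_div_assoc]
    congr 1
    simp [hjdef, pow_two]
    linear_combination (l : ℝ) ^ 2 * τ.im * hd
  have h2 : -(2 * (|(l : ℝ)| / ‖j‖) * ‖z‖) ≤ (2 * (l : ℂ) * z / j).im := by
    have := (abs_le.mp (Complex.abs_im_le_norm (2 * (l : ℂ) * z / j))).1
    have h3 : ‖2 * (l : ℂ) * z / j‖ = 2 * (|(l : ℝ)| / ‖j‖) * ‖z‖ := by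
      simp [Complex.norm_intCast]; ring
    rwa [h3] at this
  have h4 : ((c : ℂ) * z ^ 2 / j).im ≤ ‖z‖ ^ 2 / τ.im := by
    refine (Complex.abs_im_le_norm _).trans' (le_abs_self _) |>.trans ?_
    rw [norm_div, norm_mul, norm_pow, Complex.norm_intCast, div_le_div_iff₀ hJ hτ]
    nlinarith [sq_nonneg ‖z‖]
  rw [eisExponent, ← hjdef, sub_im, add_im, h1]
  set x := |(l : ℝ)| / ‖j‖
  have h5 : 2 * x * ‖z‖ ≤ τ.im / 2 * x ^ 2 + 2 * (‖z‖ ^ 2 / τ.im) := by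
    have : τ.im / 2 * x ^ 2 + 2 * (‖z‖ ^ 2 / τ.im) - 2 * x * ‖z‖ =
        (τ.im * x - 2 * ‖z‖) ^ 2 / (2 * τ.im) := by
      field_simp; ring
    have h6 : 0 ≤ (τ.im * x - 2 * ‖z‖) ^ 2 / (2 * τ.im) := by positivity
    linarith
  linarith

lemma norm_eisTerm_le (k m : ℕ) {τ : ℂ} (hτ : 0 < τ.im) (z : ℂ)
    (i : {p : ℤ × ℤ // IsCoprime p.1 p.2} × ℤ) :
    ‖eisTerm k m τ z i‖ ≤ ‖(i.1.1.1 : ℂ) * τ + i.1.1.2‖ ^ (-(k : ℤ)) *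
      (Real.exp (6 * Real.pi * m * (‖z‖ ^ 2 / τ.im)) * Real.exp (-(Real.pi * m * τ.im *
        (|(i.2 : ℝ)| / ‖(i.1.1.1 : ℂ) * τ + i.1.1.2‖) ^ 2))) := by
  have h := le_im_eisExponent hτ z (bezout_spec i.1.2) i.2
  rw [eisTerm, norm_mul, norm_zpow, norm_e2, ← Real.exp_add]
  gcongr
  rw [show ((m : ℂ) * eisExponent τ z (bezout i.1.1.1 i.1.1.2).1 (bezout i.1.1.1 i.1.1.2).2
    i.1.1.1 i.1.1.2 i.2).im = m * (eisExponent τ z (bezout i.1.1.1 i.1.1.2).1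
    (bezout i.1.1.1 i.1.1.2).2 i.1.1.1 i.1.1.2 i.2).im by simp]
  have h2 : 0 ≤ 2 * Real.pi * m := by positivity
  nlinarith [mul_le_mul_of_nonneg_left h h2]

lemma exp_neg_le_rpow {x : ℝ} (hx : 0 < x) : Real.exp (-x) ≤ x ^ (-(3 / 4) : ℝ) := by
  rw [Real.exp_neg, Real.rpow_neg hx.le]
  refine inv_anti₀ (by positivity) ?_
  rcases le_total x 1 with h | h
  · exact (Real.rpow_le_one hx.le h (by norm_num)).trans (Real.one_le_exp hx.le)
  · calc x ^ (3 / 4 : ℝ) ≤ x ^ (1 : ℝ) := Real.rpow_le_rpow_of_exponent_le h (by norm_num)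
      _ ≤ Real.exp x := by rw [Real.rpow_one]; linarith [Real.add_one_le_exp x]

open EisensteinSeries in
lemma summable_coprime_bound {s : ℝ} (hs : 2 < s) :
    Summable fun i : {p : ℤ × ℤ // IsCoprime p.1 p.2} × ℤ =>
      ‖(![i.1.1.1, i.1.1.2] : Fin 2 → ℤ)‖ ^ (-s) *
        (|(i.2 : ℝ)| ^ (-(3 / 2) : ℝ) + if i.2 = 0 then 1 else 0) := by
  have h1 : Summable fun p : {p : ℤ × ℤ // IsCoprime p.1 p.2} =>
      ‖(![p.1.1, p.1.2] : Fin 2 → ℤ)‖ ^ (-s) :=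
    (summable_one_div_norm_rpow hs).comp_injective (i := fun p :
      {p : ℤ × ℤ // IsCoprime p.1 p.2} => (![p.1.1, p.1.2] : Fin 2 → ℤ)) fun p q hpq =>
        Subtype.ext (Prod.ext (congrFun hpq 0) (congrFun hpq 1))
  have h2 : Summable fun l : ℤ => |(l : ℝ)| ^ (-(3 / 2) : ℝ) + if l = 0 then 1 else 0 :=
    (Real.summable_abs_int_rpow (by norm_num)).add (hasSum_ite_eq 0 1).summable
  exact h1.mul_of_nonneg h2 (fun _ => by positivity) fun _ => by positivity

lemma one_le_norm_of_isCoprime {c d : ℤ} (h : IsCoprime c d) :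
    1 ≤ ‖(![c, d] : Fin 2 → ℤ)‖ := by
  have h0 : c ≠ 0 ∨ d ≠ 0 := h.ne_zero_or_ne_zero
  have hone : ∀ x : ℤ, x ≠ 0 → 1 ≤ ‖x‖ := fun x hx => by
    rw [Int.norm_eq_abs]; exact_mod_cast Int.one_le_abs hx
  rcases h0 with h0 | h0
  · exact (hone c h0).trans (norm_le_pi_norm (![c, d] : Fin 2 → ℤ) 0)
  · exact (hone d h0).trans (norm_le_pi_norm (![c, d] : Fin 2 → ℤ) 1)

open EisensteinSeries in
/-- The Jacobi–Eisenstein series converges normally on `{|re τ| ≤ R, δ ≤ im τ, ‖z‖ ≤ ρ}`. -/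
lemma exists_eisTerm_bound {k m : ℕ} (hk : 4 ≤ k) (hm : m ≠ 0) {δ : ℝ} (hδ : 0 < δ) (R ρ : ℝ) :
    ∃ B : {p : ℤ × ℤ // IsCoprime p.1 p.2} × ℤ → ℝ, Summable B ∧ ∀ τ z : ℂ, δ ≤ τ.im →
      |τ.re| ≤ R → ‖z‖ ≤ ρ → ∀ i, ‖eisTerm k m τ z i‖ ≤ B i := by
  set s : ℝ := k - 3 / 2 with hs
  have hs2 : 2 < s := by
    have : (4 : ℝ) ≤ k := by exact_mod_cast hk
    rw [hs]; linarith
  set r₀ : ℝ := r ⟨⟨R, δ⟩, hδ⟩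
  have hr₀ : 0 < r₀ := r_pos _
  set C₁ := Real.exp (6 * Real.pi * m * (ρ ^ 2 / δ))
  refine ⟨fun i => (C₁ * r₀ ^ (-(k : ℝ)) + C₁ * (Real.pi * δ) ^ (-(3 / 4) : ℝ) * r₀ ^ (-s)) *
    (‖(![i.1.1.1, i.1.1.2] : Fin 2 → ℤ)‖ ^ (-s) *
      (|(i.2 : ℝ)| ^ (-(3 / 2) : ℝ) + if i.2 = 0 then 1 else 0)),
    (summable_coprime_bound hs2).mul_left _, ?_⟩
  rintro τ z h1 h2 h3 ⟨⟨⟨c, d⟩, hcd⟩, l⟩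
  have hτ : 0 < τ.im := hδ.trans_le h1
  refine (norm_eisTerm_le k m hτ z _).trans ?_
  simp only
  have hJ : 0 < ‖(c : ℂ) * τ + d‖ := norm_pos_iff.mpr (linear_ne_zero hτ (bezout_spec hcd))
  have hN : ∀ t : ℝ, 0 ≤ t → ‖(c : ℂ) * τ + d‖ ^ (-t) ≤ r₀ ^ (-t) * ‖(![c, d] : Fin 2 → ℤ)‖ ^ (-t) :=
    fun t ht => summand_bound_of_mem_verticalStrip (z := ⟨τ, hτ⟩) ht ![c, d] hδ ⟨h2, h1⟩
  have hN1 := one_le_norm_of_isCoprime hcd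
  set N := ‖(![c, d] : Fin 2 → ℤ)‖
  set J := ‖(c : ℂ) * τ + d‖
  have hρ : 0 ≤ ρ := (norm_nonneg z).trans h3
  have hC₁ : Real.exp (6 * Real.pi * m * (‖z‖ ^ 2 / τ.im)) ≤ C₁ := by
    simp only [C₁]; gcongr
  have hC₁0 : 0 < C₁ := Real.exp_pos _
  rw [← Real.rpow_intCast, Int.cast_neg, Int.cast_natCast]
  have hm1 : (1 : ℝ) ≤ m := by exact_mod_cast Nat.one_le_iff_ne_zero.mpr hm
  rcases eq_or_ne l 0 with rfl | hl
  · have hk' := hN k (by positivity)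
    have : N ^ (-(k : ℝ)) ≤ N ^ (-s) :=
      Real.rpow_le_rpow_of_exponent_le hN1 (by rw [hs]; linarith)
    calc J ^ (-(k : ℝ)) * _ ≤ (r₀ ^ (-(k : ℝ)) * N ^ (-s)) * (C₁ * 1) := by
          gcongr
          · exact hk'.trans (by gcongr)
          · simp
      _ = C₁ * r₀ ^ (-(k : ℝ)) * (N ^ (-s) * 1) := by ring
      _ ≤ _ := by
          gcongr
          · exact le_add_of_nonneg_right (by positivity)
          · simp
  · have hl' : 0 < |(l : ℝ)| := by positivity
    have hx : 0 < |(l : ℝ)| / J := by positivity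
    have hexp : Real.exp (-(Real.pi * m * τ.im * (|(l : ℝ)| / J) ^ 2)) ≤
        (Real.pi * δ) ^ (-(3 / 4) : ℝ) * (|(l : ℝ)| ^ (-(3 / 2) : ℝ) * J ^ (3 / 2 : ℝ)) := by
      calc _ ≤ Real.exp (-(Real.pi * δ * (|(l : ℝ)| / J) ^ 2)) := by
            have h5 : Real.pi * δ ≤ Real.pi * m * τ.im := by
              have := Real.pi_pos
              rw [mul_assoc]
              exact mul_le_mul_of_nonneg_left (by nlinarith) this.le
            exact Real.exp_le_exp.mpr (neg_le_neg (mul_le_mul_of_nonneg_right h5 (sq_nonneg _)))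
        _ ≤ (Real.pi * δ * (|(l : ℝ)| / J) ^ 2) ^ (-(3 / 4) : ℝ) :=
            exp_neg_le_rpow (by positivity)
        _ = _ := by
            rw [Real.mul_rpow (by positivity) (by positivity), ← Real.rpow_natCast (_ / J),
              ← Real.rpow_mul hx.le, show ((2 : ℕ) : ℝ) * (-(3 / 4)) = -(3 / 2) by norm_num,
              Real.div_rpow hl'.le hJ.le, Real.rpow_neg hJ.le, div_inv_eq_mul]
    have hJs : J ^ (-(k : ℝ)) * J ^ (3 / 2 : ℝ) = J ^ (-s) := by
      rw [← Real.rpow_add hJ, hs]; congr 1; ring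
    calc J ^ (-(k : ℝ)) * _ ≤ J ^ (-(k : ℝ)) * (C₁ * ((Real.pi * δ) ^ (-(3 / 4) : ℝ) *
          (|(l : ℝ)| ^ (-(3 / 2) : ℝ) * J ^ (3 / 2 : ℝ)))) := by gcongr
      _ = C₁ * (Real.pi * δ) ^ (-(3 / 4) : ℝ) * |(l : ℝ)| ^ (-(3 / 2) : ℝ) * J ^ (-s) := by
          rw [← hJs]; ring
      _ ≤ C₁ * (Real.pi * δ) ^ (-(3 / 4) : ℝ) * |(l : ℝ)| ^ (-(3 / 2) : ℝ) *
          (r₀ ^ (-s) * N ^ (-s)) := by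
          gcongr
          exact hN s (by linarith)
      _ = C₁ * (Real.pi * δ) ^ (-(3 / 4) : ℝ) * r₀ ^ (-s) *
          (N ^ (-s) * |(l : ℝ)| ^ (-(3 / 2) : ℝ)) := by ring
      _ ≤ _ := by
          gcongr
          · exact le_add_of_nonneg_left (by positivity)
          · simp [hl]

/-- The terms of the Jacobi–Eisenstein series attached to `c ≠ 0`, or to `l ≠ 0`, vanish at the
cusp. -/
lemma tendsto_eisTerm {k m : ℕ} (hk : k ≠ 0) (hke : Even k) (hm : m ≠ 0)
    (i : {p : ℤ × ℤ // IsCoprime p.1 p.2} × ℤ) :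
    Filter.Tendsto (fun p : ℂ × ℂ => eisTerm k m p.1 p.2 i) cuspFilter
      (nhds (if i.1.1.1 = 0 ∧ i.2 = 0 then 1 else 0)) := by
  obtain ⟨⟨⟨c, d⟩, hcd⟩, l⟩ := i
  have him : Filter.Tendsto (fun p : ℂ × ℂ => p.1.im) cuspFilter Filter.atTop :=
    Filter.tendsto_comap.mono_left inf_le_left
  have hmπ : 0 < Real.pi * m := by positivity
  have hev : ∀ᶠ p : ℂ × ℂ in cuspFilter, 1 ≤ p.1.im ∧ ‖p.2‖ ≤ 1 :=
    eventually_cuspFilter.mpr ⟨1, fun τ z h1 _ h3 => ⟨h1, h3⟩⟩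
  have hexp : ∀ {τ z : ℂ}, 1 ≤ τ.im → ‖z‖ ≤ 1 →
      Real.exp (6 * Real.pi * m * (‖z‖ ^ 2 / τ.im)) ≤ Real.exp (6 * Real.pi * m) := by
    intro τ z h1 h2
    refine Real.exp_le_exp.mpr (mul_le_of_le_one_right (by positivity) ?_)
    exact div_le_one_of_le₀ ((pow_le_one₀ (norm_nonneg z) h2).trans h1) (by linarith)
  rcases eq_or_ne c 0 with rfl | hc
  · have hd : d = 1 ∨ d = -1 := Int.isUnit_iff.mp (isCoprime_zero_left.mp hcd)
    have hd1 : ‖(d : ℂ)‖ = 1 := by rcases hd with rfl | rfl <;> simp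
    have hdk : (d : ℂ) ^ (-(k : ℤ)) = 1 := by
      rcases hd with rfl | rfl
      · simp
      · rw [Int.cast_neg, Int.cast_one, Even.neg_one_zpow (by simpa using hke)]
    rcases eq_or_ne l 0 with rfl | hl
    · simpa [eisTerm, eisExponent, hdk, e2_zero] using tendsto_const_nhds
    · simp only [hl, and_false, if_false]
      refine squeeze_zero_norm' (a := fun p : ℂ × ℂ => Real.exp (6 * Real.pi * m) *
        Real.exp (-(Real.pi * m * p.1.im))) ?_ ?_
      · filter_upwards [hev] with p hp
        refine (norm_eisTerm_le k m (by linarith) _ _).trans ?_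
        have hl1 : (1 : ℝ) ≤ |(l : ℝ)| := by exact_mod_cast Int.one_le_abs hl
        simp only [Int.cast_zero, zero_mul, zero_add, hd1, one_zpow, one_mul, div_one]
        refine mul_le_mul (hexp hp.1 hp.2) ?_ (Real.exp_nonneg _) (Real.exp_nonneg _)
        refine Real.exp_le_exp.mpr (neg_le_neg (le_mul_of_one_le_right ?_ (one_le_pow₀ hl1)))
        exact mul_nonneg hmπ.le (by linarith)
      · have := (Real.tendsto_exp_neg_atTop_nhds_zero.comp (him.const_mul_atTop hmπ)).const_mul
          (Real.exp (6 * Real.pi * m))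
        simpa [Function.comp_def] using this
  · simp only [hc, false_and, if_false]
    refine squeeze_zero_norm' (a := fun p : ℂ × ℂ => p.1.im ^ (-(k : ℤ)) *
      (Real.exp (6 * Real.pi * m) * 1)) ?_ ?_
    · filter_upwards [hev] with p hp
      have h0 : 0 < p.1.im := by linarith
      refine (norm_eisTerm_le k m h0 _ _).trans ?_
      have hc1 : (1 : ℝ) ≤ |(c : ℝ)| := by exact_mod_cast Int.one_le_abs hc
      have hj : p.1.im ≤ ‖(c : ℂ) * p.1 + d‖ := by
        have := Complex.abs_im_le_norm ((c : ℂ) * p.1 + d)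
        simp only [add_im, mul_im, intCast_re, intCast_im, zero_mul, add_zero, abs_mul,
          abs_of_pos h0] at this
        nlinarith
      refine mul_le_mul ?_ (mul_le_mul (hexp hp.1 hp.2) ?_ (Real.exp_nonneg _)
        (Real.exp_nonneg _)) (by positivity) (by positivity)
      · rw [zpow_neg, zpow_neg, zpow_natCast, zpow_natCast]
        gcongr
      · rw [Real.exp_le_one_iff, neg_nonpos]
        positivity
    · have := ((tendsto_pow_neg_atTop hk).comp him).mul_const (Real.exp (6 * Real.pi * m) * 1)
      simpa [Function.comp_def] using this

lemma EisJ_eq_tsum_eisTerm {k m : ℕ} (hk : 4 ≤ k) (hm : m ≠ 0) {τ : ℂ} (hτ : 0 < τ.im) (z : ℂ) :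
    EisJ k m τ z = 1 / 2 * ∑' i, eisTerm k m τ z i := by
  obtain ⟨B, hB, hle⟩ := exists_eisTerm_bound hk hm hτ |τ.re| ‖z‖
  have hs : Summable (eisTerm k m τ z) := hB.of_norm_bounded (hle τ z le_rfl le_rfl le_rfl)
  rw [EisJ, hs.tsum_prod]
  congr 1
  exact tsum_congr fun p => tsum_mul_left.symm

lemma differentiable_eisTerm_z (k m : ℕ) (τ : ℂ) (i : {p : ℤ × ℤ // IsCoprime p.1 p.2} × ℤ) :
    Differentiable ℂ fun z => eisTerm k m τ z i := by
  unfold eisTerm eisExponent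
  exact (differentiable_e2.comp (by fun_prop)).const_mul _

lemma differentiableOn_eisTerm_τ (k m : ℕ) (z : ℂ)
    (i : {p : ℤ × ℤ // IsCoprime p.1 p.2} × ℤ) :
    DifferentiableOn ℂ (fun τ => eisTerm k m τ z i) {τ | 0 < τ.im} := by
  intro τ hτ
  have hj := linear_ne_zero (τ := τ) hτ (bezout_spec i.1.2)
  unfold eisTerm eisExponent
  refine DifferentiableAt.differentiableWithinAt (.mul ?_ (differentiable_e2.differentiableAt.comp
    τ ?_))
  · exact DifferentiableAt.zpow (by fun_prop) (.inl hj)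
  · fun_prop (disch := exact hj)

/-- The Jacobi–Eisenstein series is a Jacobi form with constant term `1`. -/
lemma jacobiLike_EisJ {k m : ℕ} (hk : 4 ≤ k) (hke : Even k) (hm : m ≠ 0) :
    JacobiLike k m 1 (EisJ k m) where
  diff_z τ hτ z := by
    obtain ⟨B, hB, hle⟩ := exists_eisTerm_bound hk hm hτ |τ.re| (‖z‖ + 1)
    have h := differentiableOn_tsum_of_summable_norm (U := Metric.ball 0 (‖z‖ + 1)) hB
      (fun i => (differentiable_eisTerm_z k m τ i).differentiableOn) Metric.isOpen_ball
      fun i w hw => hle τ w le_rfl le_rfl (by simpa using (mem_ball_zero_iff.mp hw).le) i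
    rw [show EisJ k m τ = _ from funext (EisJ_eq_tsum_eisTerm hk hm hτ)]
    exact (h.differentiableAt (Metric.isOpen_ball.mem_nhds (by simp))).const_mul _
  diff_τ z τ hτ := by
    obtain ⟨B, hB, hle⟩ := exists_eisTerm_bound hk hm (half_pos hτ) (|τ.re| + 1) ‖z‖
    set U : Set ℂ := {w | τ.im / 2 < w.im ∧ |w.re| < |τ.re| + 1}
    have hU : IsOpen U := (isOpen_lt continuous_const continuous_im).inter
      (isOpen_lt continuous_re.abs continuous_const)
    have hτU : τ ∈ U := ⟨half_lt_self hτ, lt_add_one _⟩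
    have hU0 : ∀ w ∈ U, 0 < w.im := fun w hw => (half_pos hτ).trans hw.1
    have h := differentiableOn_tsum_of_summable_norm (U := U) hB
      (fun i => (differentiableOn_eisTerm_τ k m z i).mono hU0) hU
      fun i w hw => hle w z hw.1.le hw.2.le le_rfl i
    refine DifferentiableAt.differentiableWithinAt (DifferentiableAt.congr_of_eventuallyEq
      ((h.differentiableAt (hU.mem_nhds hτU)).const_mul (1 / 2)) ?_)
    filter_upwards [hU.mem_nhds hτU] with w hw
    exact EisJ_eq_tsum_eisTerm hk hm (hU0 w hw) z
  bdd τ hτ := by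
    obtain ⟨B, hB, hle⟩ := exists_eisTerm_bound hk hm (half_pos hτ) (|τ.re| + 1) 1
    refine ⟨1 / 2 * ∑' i, B i, ?_⟩
    filter_upwards [(isOpen_lt continuous_const continuous_im).mem_nhds
      (show τ.im / 2 < τ.im from half_lt_self hτ),
      (isOpen_lt continuous_re.abs continuous_const).mem_nhds
      (show |τ.re| < |τ.re| + 1 from lt_add_one _)] with w h1 h2 z hz
    rw [EisJ_eq_tsum_eisTerm hk hm ((half_pos hτ).trans h1), norm_mul]
    refine mul_le_mul (by simp) ?_ (norm_nonneg _) (by norm_num)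
    exact tsum_of_norm_bounded hB.hasSum (hle w z (le_of_lt h1) (le_of_lt h2) hz)
  cusp := by
    obtain ⟨B, hB, hle⟩ := exists_eisTerm_bound hk hm one_pos 1 1
    have hev : ∀ᶠ p : ℂ × ℂ in cuspFilter, 1 ≤ p.1.im ∧ |p.1.re| ≤ 1 ∧ ‖p.2‖ ≤ 1 :=
      eventually_cuspFilter.mpr ⟨1, fun τ z h1 h2 h3 => ⟨h1, h2, h3⟩⟩
    have h := (tendsto_tsum_of_dominated_convergence hB
      (tendsto_eisTerm (by omega : k ≠ 0) hke hm) (hev.mono fun p hp =>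
        hle p.1 p.2 hp.1 hp.2.1 hp.2.2)).const_mul (1 / 2)
    have hsum : ∑' i : {p : ℤ × ℤ // IsCoprime p.1 p.2} × ℤ,
        (if i.1.1.1 = 0 ∧ i.2 = 0 then (1 : ℂ) else 0) = 2 := by
      let x (d : ℤ) (hd : IsUnit d) : {p : ℤ × ℤ // IsCoprime p.1 p.2} × ℤ :=
        (⟨(0, d), isCoprime_zero_left.mpr hd⟩, 0)
      rw [tsum_eq_sum (s := {x 1 isUnit_one, x (-1) isUnit_one.neg}), Finset.sum_pair]
      · norm_num [x]
      · simp [x]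
      · rintro ⟨⟨⟨c, d⟩, hcd⟩, l⟩ hi
        refine if_neg ?_
        rintro ⟨hc, hl⟩
        simp only at hc hl
        subst hc hl
        rcases Int.isUnit_iff.mp (isCoprime_zero_left.mp hcd) with hd | hd <;>
          · simp only at hd
            subst hd
            simp [x] at hi
    rw [hsum, one_div_mul_cancel two_ne_zero] at h
    refine h.congr' (hev.mono fun p hp => (EisJ_eq_tsum_eisTerm hk hm ?_ _).symm)
    linarith
  map_T τ z hτ := EisJ_map_T k m hτ z
  map_S τ z hτ := EisJ_map_S k m hτ z
  map_add_one τ z hτ := EisJ_add_one k m hτ z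
  map_add_self τ z hτ := EisJ_add_self k m hτ z

/-! ### The theta functions -/

lemma theta00_eq (τ z : ℂ) : theta00 τ z = jacobiTheta₂ z τ := by
  refine tsum_congr fun n => ?_
  rw [jacobiTheta₂_term]; ring_nf

lemma exp_pi_mul_I_int (n : ℤ) : cexp (Real.pi * I * n) = (-1) ^ n := by
  rw [mul_comm, Complex.exp_int_mul, Complex.exp_pi_mul_I]

lemma theta01_eq (τ z : ℂ) : theta01 τ z = jacobiTheta₂ (z + 1 / 2) τ := by
  refine tsum_congr fun n => ?_
  rw [jacobiTheta₂_term, ← exp_pi_mul_I_int, ← Complex.exp_add]; ring_nf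

lemma theta10_eq (τ z : ℂ) : theta10 τ z =
    cexp (Real.pi * I * τ / 4 + Real.pi * I * z) * jacobiTheta₂ (z + τ / 2) τ := by
  rw [theta10, Complex.exp_add]
  congr 1
  refine tsum_congr fun n => ?_
  rw [jacobiTheta₂_term]; ring_nf

lemma theta00_add_one_left (τ z : ℂ) : theta00 (τ + 1) z = theta01 τ z := by
  refine tsum_congr fun n => ?_
  rw [← exp_pi_mul_I_int, ← Complex.exp_add, Complex.exp_eq_exp_iff_exists_int]
  obtain ⟨j, hj⟩ : Even (n ^ 2 - n) := by simp [Int.even_sub, Int.even_pow]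
  refine ⟨j, ?_⟩
  have hj' : (n : ℂ) ^ 2 - n = j + j := by exact_mod_cast hj
  linear_combination Real.pi * I * hj'

lemma theta01_add_one_left (τ z : ℂ) : theta01 (τ + 1) z = theta00 τ z := by
  rw [← theta00_add_one_left, theta00_eq, theta00_eq, add_assoc, one_add_one_eq_two,
    jacobiTheta₂_add_right]

lemma theta10_add_one_left (τ z : ℂ) :
    theta10 (τ + 1) z = cexp (Real.pi * I / 4) * theta10 τ z := by
  rw [theta10_eq, theta10_eq, ← theta00_eq, theta00_add_one_left, theta01_eq,
    show z + (τ + 1) / 2 + 1 / 2 = z + τ / 2 + 1 by ring, jacobiTheta₂_add_left, ← mul_assoc,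
    ← Complex.exp_add]
  ring_nf

/-- The automorphy factor of the theta functions under `τ ↦ -1/τ`. -/
def thetaFactor (τ z : ℂ) : ℂ := (-I * τ) ^ (1 / 2 : ℂ) * cexp (Real.pi * I * z ^ 2 / τ)

lemma jacobiTheta₂_neg_inv {τ : ℂ} (hτ : 0 < τ.im) (z : ℂ) :
    jacobiTheta₂ (z / τ) (-1 / τ) = thetaFactor τ z * jacobiTheta₂ z τ := by
  have hτ0 : τ ≠ 0 := fun h0 => by simp [h0] at hτ
  have hs : (-I * τ) ^ (1 / 2 : ℂ) ≠ 0 := by simp [Complex.cpow_eq_zero_iff, hτ0]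
  rw [jacobiTheta₂_functional_equation z τ, thetaFactor, show -(Real.pi : ℂ) * I * z ^ 2 / τ =
    -(Real.pi * I * z ^ 2 / τ) by ring, Complex.exp_neg]
  field_simp [Complex.exp_ne_zero]

lemma theta00_neg_inv {τ : ℂ} (hτ : 0 < τ.im) (z : ℂ) :
    theta00 (-1 / τ) (z / τ) = thetaFactor τ z * theta00 τ z := by
  rw [theta00_eq, theta00_eq, jacobiTheta₂_neg_inv hτ]

lemma theta01_neg_inv {τ : ℂ} (hτ : 0 < τ.im) (z : ℂ) :
    theta01 (-1 / τ) (z / τ) = thetaFactor τ z * theta10 τ z := by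
  have hτ0 : τ ≠ 0 := fun h0 => by simp [h0] at hτ
  rw [theta01_eq, theta10_eq, show z / τ + 1 / 2 = (z + τ / 2) / τ by field_simp,
    jacobiTheta₂_neg_inv hτ, thetaFactor, thetaFactor]
  have h : cexp (Real.pi * I * (z + τ / 2) ^ 2 / τ) =
      cexp (Real.pi * I * z ^ 2 / τ) * cexp (Real.pi * I * τ / 4 + Real.pi * I * z) := by
    rw [← Complex.exp_add]
    congr 1
    field_simp
    ring
  rw [h]
  ring

lemma theta10_neg_inv {τ : ℂ} (hτ : 0 < τ.im) (z : ℂ) :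
    theta10 (-1 / τ) (z / τ) = thetaFactor τ z * theta01 τ z := by
  have hτ0 : τ ≠ 0 := fun h0 => by simp [h0] at hτ
  rw [theta01_eq, theta10_eq, show z / τ + -1 / τ / 2 = (z - 1 / 2) / τ by field_simp; ring,
    jacobiTheta₂_neg_inv hτ, thetaFactor, thetaFactor,
    show z + 1 / 2 = z - 1 / 2 + 1 by ring, jacobiTheta₂_add_left]
  have h : cexp (Real.pi * I * z ^ 2 / τ) = cexp (Real.pi * I * (-1 / τ) / 4 +
      Real.pi * I * (z / τ)) * cexp (Real.pi * I * (z - 1 / 2) ^ 2 / τ) := by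
    rw [← Complex.exp_add]
    congr 1
    field_simp
    ring
  rw [h]
  ring

lemma theta00_add_one (τ z : ℂ) : theta00 τ (z + 1) = theta00 τ z := by
  rw [theta00_eq, theta00_eq, jacobiTheta₂_add_left]

lemma theta01_add_one (τ z : ℂ) : theta01 τ (z + 1) = theta01 τ z := by
  rw [theta01_eq, theta01_eq, add_right_comm, jacobiTheta₂_add_left]

lemma theta10_add_one (τ z : ℂ) : theta10 τ (z + 1) = -theta10 τ z := by
  rw [theta10_eq, theta10_eq, add_right_comm, jacobiTheta₂_add_left, mul_add, mul_one, ← add_assoc,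
    Complex.exp_add, Complex.exp_pi_mul_I]
  ring

lemma theta00_add_self (τ z : ℂ) :
    theta00 τ (z + τ) = cexp (-(Real.pi * I * (τ + 2 * z))) * theta00 τ z := by
  rw [theta00_eq, theta00_eq, jacobiTheta₂_add_left']
  ring_nf

lemma theta01_add_self (τ z : ℂ) :
    theta01 τ (z + τ) = -(cexp (-(Real.pi * I * (τ + 2 * z))) * theta01 τ z) := by
  rw [theta01_eq, theta01_eq, add_right_comm, jacobiTheta₂_add_left', show -(Real.pi : ℂ) * I *
    (τ + 2 * (z + 1 / 2)) = -(Real.pi * I * (τ + 2 * z)) - Real.pi * I by ring, Complex.exp_sub,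
    Complex.exp_pi_mul_I]
  ring

lemma theta10_add_self (τ z : ℂ) :
    theta10 τ (z + τ) = cexp (-(Real.pi * I * (τ + 2 * z))) * theta10 τ z := by
  rw [theta10_eq, theta10_eq, add_right_comm, jacobiTheta₂_add_left', ← mul_assoc, ← mul_assoc,
    ← Complex.exp_add, ← Complex.exp_add]
  ring_nf

lemma differentiableOn_jacobiTheta₂_comp {w : ℂ × ℂ → ℂ} (hw : Differentiable ℂ w) :
    DifferentiableOn ℂ (fun p : ℂ × ℂ => jacobiTheta₂ (w p) p.1) {p | 0 < p.1.im} := fun p hp =>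
  ((hasFDerivAt_jacobiTheta₂ (w p) hp).differentiableAt.comp (f := fun p : ℂ × ℂ => (w p, p.1)) p
    (by fun_prop)).differentiableWithinAt

lemma differentiableOn_theta00_comp {w : ℂ × ℂ → ℂ} (hw : Differentiable ℂ w) :
    DifferentiableOn ℂ (fun p : ℂ × ℂ => theta00 p.1 (w p)) {p | 0 < p.1.im} := by
  simp only [theta00_eq]
  exact differentiableOn_jacobiTheta₂_comp hw

lemma differentiableOn_theta01_comp {w : ℂ × ℂ → ℂ} (hw : Differentiable ℂ w) :
    DifferentiableOn ℂ (fun p : ℂ × ℂ => theta01 p.1 (w p)) {p | 0 < p.1.im} := by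
  simp only [theta01_eq]
  exact differentiableOn_jacobiTheta₂_comp (by fun_prop)

lemma differentiableOn_theta10_comp {w : ℂ × ℂ → ℂ} (hw : Differentiable ℂ w) :
    DifferentiableOn ℂ (fun p : ℂ × ℂ => theta10 p.1 (w p)) {p | 0 < p.1.im} := by
  simp only [theta10_eq]
  exact .mul (by fun_prop) (differentiableOn_jacobiTheta₂_comp (by fun_prop))

lemma tendsto_im_cuspFilter :
    Filter.Tendsto (fun p : ℂ × ℂ => p.1.im) cuspFilter Filter.atTop :=
  Filter.tendsto_comap.mono_left inf_le_left

lemma eventually_im_cuspFilter : ∀ᶠ p : ℂ × ℂ in cuspFilter, 1 ≤ p.1.im ∧ |p.2.im| ≤ 1 :=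
  eventually_cuspFilter.mpr ⟨1, fun _ z h1 _ h3 => ⟨h1, (Complex.abs_im_le_norm z).trans h3⟩⟩

lemma tendsto_jacobiTheta₂_cusp {w : ℂ × ℂ → ℂ}
    (hw : ∀ᶠ p in cuspFilter, |(w p).im| ≤ 1) :
    Filter.Tendsto (fun p : ℂ × ℂ => jacobiTheta₂ (w p) p.1) cuspFilter (nhds 1) := by
  have hB : Summable fun n : ℤ => Real.exp (-Real.pi * (1 * n ^ 2 - 2 * 1 * |n|)) := by
    simpa using summable_pow_mul_jacobiTheta₂_term_bound 1 one_pos 0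
  have h := tendsto_tsum_of_dominated_convergence (g := fun n : ℤ => if n = 0 then (1 : ℂ) else 0)
    (f := fun (p : ℂ × ℂ) (n : ℤ) => jacobiTheta₂_term n (w p) p.1) (𝓕 := cuspFilter) hB
    (fun n => ?_) ?_
  · simpa [jacobiTheta₂] using h
  · rcases eq_or_ne n 0 with rfl | hn
    · simpa [jacobiTheta₂_term] using tendsto_const_nhds
    · simp only [hn, if_false]
      refine squeeze_zero_norm' (a := fun p : ℂ × ℂ => Real.exp (2 * Real.pi * |n|) *
        Real.exp (-(Real.pi * p.1.im))) ?_ ?_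
      · filter_upwards [eventually_im_cuspFilter, hw] with p hp hwp
        refine (norm_jacobiTheta₂_term_le (by linarith) hwp le_rfl n).trans ?_
        have hn1 : (1 : ℝ) ≤ |(n : ℝ)| := by exact_mod_cast Int.one_le_abs hn
        have hn2 : (1 : ℝ) ≤ (n : ℝ) ^ 2 := by rw [← sq_abs]; exact one_le_pow₀ hn1
        rw [← Real.exp_add, Real.exp_le_exp]
        have : p.1.im ≤ p.1.im * n ^ 2 := le_mul_of_one_le_right (by linarith) hn2
        push_cast
        nlinarith [mul_le_mul_of_nonneg_left this Real.pi_pos.le]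
      · simpa [Function.comp_def] using (Real.tendsto_exp_neg_atTop_nhds_zero.comp
          (tendsto_im_cuspFilter.const_mul_atTop Real.pi_pos)).const_mul
          (Real.exp (2 * Real.pi * |n|))
  · filter_upwards [eventually_im_cuspFilter, hw] with p hp hwp n
    exact norm_jacobiTheta₂_term_le one_pos hwp hp.1 n

lemma tendsto_theta00_cusp {w : ℂ × ℂ → ℂ} (hw : ∀ᶠ p in cuspFilter, |(w p).im| ≤ 1) :
    Filter.Tendsto (fun p : ℂ × ℂ => theta00 p.1 (w p)) cuspFilter (nhds 1) := by
  simp only [theta00_eq]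
  exact tendsto_jacobiTheta₂_cusp hw

lemma tendsto_theta01_cusp {w : ℂ × ℂ → ℂ} (hw : ∀ᶠ p in cuspFilter, |(w p).im| ≤ 1) :
    Filter.Tendsto (fun p : ℂ × ℂ => theta01 p.1 (w p)) cuspFilter (nhds 1) := by
  simp only [theta01_eq]
  exact tendsto_jacobiTheta₂_cusp (by simpa using hw)

lemma tendsto_theta10_cusp {w : ℂ × ℂ → ℂ} (hw : ∀ᶠ p in cuspFilter, |(w p).im| ≤ 1) :
    Filter.Tendsto (fun p : ℂ × ℂ => theta10 p.1 (w p)) cuspFilter (nhds 0) := by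
  have hB : Summable fun n : ℤ => Real.exp (-Real.pi * (1 * n ^ 2 - 2 * (3 / 2) * |n|)) := by
    simpa using summable_pow_mul_jacobiTheta₂_term_bound (3 / 2) one_pos 0
  simp only [theta10_eq]
  refine squeeze_zero_norm' (a := fun p : ℂ × ℂ => Real.exp (-(Real.pi / 4 * p.1.im)) *
    (Real.exp Real.pi * ∑' n : ℤ, Real.exp (-Real.pi * (1 * n ^ 2 - 2 * (3 / 2) * |n|)))) ?_ ?_
  · filter_upwards [eventually_im_cuspFilter, hw] with p hp hwp
    rw [norm_mul, ← mul_assoc, ← Real.exp_add, Complex.norm_exp]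
    have hw' := abs_le.mp hwp
    refine mul_le_mul (Real.exp_le_exp.mpr ?_) (tsum_of_norm_bounded hB.hasSum fun n => ?_)
      (norm_nonneg _) (Real.exp_nonneg _)
    · simp
      nlinarith [Real.pi_pos]
    · have h2 : |(w p + p.1 / 2).im| ≤ 1 + p.1.im / 2 := by
        have : (w p + p.1 / 2).im = (w p).im + p.1.im / 2 := by simp
        rw [this, abs_le]
        constructor <;> linarith
      refine (norm_jacobiTheta₂_term_le (by linarith) h2 le_rfl n).trans ?_
      have h3 : (|n| : ℝ) ≤ (n : ℝ) ^ 2 := by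
        rw [← sq_abs]
        exact_mod_cast Int.le_self_sq |n|
      rw [Real.exp_le_exp, neg_mul, neg_mul, neg_le_neg_iff]
      refine mul_le_mul_of_nonneg_left ?_ Real.pi_pos.le
      push_cast
      nlinarith [mul_nonneg (sub_nonneg.mpr hp.1) (sub_nonneg.mpr h3)]
  · simpa [Function.comp_def] using (Real.tendsto_exp_neg_atTop_nhds_zero.comp
      (tendsto_im_cuspFilter.const_mul_atTop (by positivity : 0 < Real.pi / 4))).mul_const _

/-! ### Jacobi forms as polynomials in theta functions -/

lemma differentiable_of_joint {φ : ℂ → ℂ → ℂ}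
    (h : DifferentiableOn ℂ (fun p : ℂ × ℂ => φ p.1 p.2) {p | 0 < p.1.im}) {τ : ℂ}
    (hτ : 0 < τ.im) : Differentiable ℂ (φ τ) :=
  differentiableOn_univ.mp <| h.comp (f := fun z : ℂ => (τ, z)) (s := Set.univ)
    (by fun_prop) fun _ _ => hτ

lemma differentiableOn_left_of_joint {φ : ℂ → ℂ → ℂ}
    (h : DifferentiableOn ℂ (fun p : ℂ × ℂ => φ p.1 p.2) {p | 0 < p.1.im}) (z : ℂ) :
    DifferentiableOn ℂ (fun τ => φ τ z) {τ | 0 < τ.im} :=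
  h.comp (f := fun τ : ℂ => (τ, z)) (by fun_prop) fun _ hτ => hτ

lemma exists_bound_of_joint {φ : ℂ → ℂ → ℂ}
    (h : DifferentiableOn ℂ (fun p : ℂ × ℂ => φ p.1 p.2) {p | 0 < p.1.im}) {τ₀ : ℂ}
    (hτ₀ : 0 < τ₀.im) : ∃ M : ℝ, ∀ᶠ τ in nhds τ₀, ∀ z, ‖z‖ ≤ 1 → ‖φ τ z‖ ≤ M := by
  obtain ⟨K, hK, hKU, hKc⟩ := exists_compact_subset (isOpen_lt continuous_const continuous_im) hτ₀
  obtain ⟨M, hM⟩ := (hK.prod (isCompact_closedBall (0 : ℂ) 1)).exists_bound_of_continuousOn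
    (h.continuousOn.mono fun p hp => hKc hp.1)
  refine ⟨M, ?_⟩
  filter_upwards [mem_interior_iff_mem_nhds.mp hKU] with τ hτ z hz
  exact hM (τ, z) ⟨hτ, by simpa using hz⟩

/-- The combination of `2m`-th powers of the theta functions with coefficients `α`, `β`, `γ`. -/
def thetaSum (m : ℕ) (α β γ : ℂ → ℂ) (τ z : ℂ) : ℂ :=
  1 / 2 * (α τ * (theta00 τ z ^ (2 * m) * theta00 τ 0 ^ (8 - 2 * m)) +
    β τ * (theta01 τ z ^ (2 * m) * theta01 τ 0 ^ (8 - 2 * m)) +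
    γ τ * (theta10 τ z ^ (2 * m) * theta10 τ 0 ^ (8 - 2 * m)))

lemma thetaFactor_pow (τ z : ℂ) {m : ℕ} (hm : m ≤ 4) :
    thetaFactor τ z ^ (2 * m) * thetaFactor τ 0 ^ (8 - 2 * m) =
      τ ^ 4 * e2 (m * (z ^ 2 / τ)) := by
  have hs : ((-I * τ) ^ (1 / 2 : ℂ)) ^ 8 = τ ^ 4 := by
    rw [← Complex.cpow_nat_mul, show ((8 : ℕ) : ℂ) * (1 / 2) = (4 : ℕ) by norm_num,
      Complex.cpow_natCast, mul_pow, neg_pow, Complex.I_pow_four]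
    norm_num
  have he : cexp (Real.pi * I * z ^ 2 / τ) ^ (2 * m) = e2 (m * (z ^ 2 / τ)) := by
    rw [← Complex.exp_nat_mul, e2]
    congr 1
    push_cast
    ring
  rw [thetaFactor, thetaFactor, mul_pow, he, ← hs]
  obtain ⟨j, hj⟩ : ∃ j, 8 - 2 * m = j := ⟨_, rfl⟩
  have h8 : 8 = 2 * m + j := by omega
  rw [hj, h8, pow_add]
  simp
  ring

lemma theta10_pow_add_one_left {m : ℕ} (hm : m ≤ 4) (τ z : ℂ) :
    theta10 (τ + 1) z ^ (2 * m) * theta10 (τ + 1) 0 ^ (8 - 2 * m) =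
      theta10 τ z ^ (2 * m) * theta10 τ 0 ^ (8 - 2 * m) := by
  have h8 : cexp (Real.pi * I / 4) ^ (2 * m) * cexp (Real.pi * I / 4) ^ (8 - 2 * m) = 1 := by
    rw [← pow_add, show 2 * m + (8 - 2 * m) = 8 by omega, ← Complex.exp_nat_mul,
      ← Complex.exp_two_pi_mul_I]
    congr 1
    push_cast
    ring
  rw [theta10_add_one_left, theta10_add_one_left, mul_pow, mul_pow]
  linear_combination theta10 τ z ^ (2 * m) * theta10 τ 0 ^ (8 - 2 * m) * h8

lemma jacobiLike_thetaSum {m n : ℕ} (hm : m ≤ 4) {α β γ : ℂ → ℂ} {γ₀ : ℂ}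
    (hα : DifferentiableOn ℂ α {τ | 0 < τ.im}) (hβ : DifferentiableOn ℂ β {τ | 0 < τ.im})
    (hγ : DifferentiableOn ℂ γ {τ | 0 < τ.im})
    (cα : Filter.Tendsto (fun p : ℂ × ℂ => α p.1) cuspFilter (nhds 1))
    (cβ : Filter.Tendsto (fun p : ℂ × ℂ => β p.1) cuspFilter (nhds 1))
    (cγ : Filter.Tendsto (fun p : ℂ × ℂ => γ p.1) cuspFilter (nhds γ₀))
    (tα : ∀ τ, α (τ + 1) = β τ) (tβ : ∀ τ, β (τ + 1) = α τ) (tγ : ∀ τ, γ (τ + 1) = γ τ)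
    (sα : ∀ τ, 0 < τ.im → α (-1 / τ) = τ ^ n * α τ)
    (sβ : ∀ τ, 0 < τ.im → β (-1 / τ) = τ ^ n * γ τ)
    (sγ : ∀ τ, 0 < τ.im → γ (-1 / τ) = τ ^ n * β τ) (hm0 : m ≠ 0) :
    JacobiLike (n + 4) m 1 (thetaSum m α β γ) := by
  have hd : DifferentiableOn ℂ (fun p : ℂ × ℂ => thetaSum m α β γ p.1 p.2) {p | 0 < p.1.im} := by
    have hfst : DifferentiableOn ℂ (fun p : ℂ × ℂ => p.1) {p | 0 < p.1.im} := by fun_prop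
    have hmaps : Set.MapsTo (fun p : ℂ × ℂ => p.1) {p | 0 < p.1.im} {τ | 0 < τ.im} := fun _ h => h
    have h00 := differentiableOn_theta00_comp (w := Prod.snd) (by fun_prop)
    have h01 := differentiableOn_theta01_comp (w := Prod.snd) (by fun_prop)
    have h10 := differentiableOn_theta10_comp (w := Prod.snd) (by fun_prop)
    have k00 := differentiableOn_theta00_comp (w := fun _ => 0) (by fun_prop)
    have k01 := differentiableOn_theta01_comp (w := fun _ => 0) (by fun_prop)
    have k10 := differentiableOn_theta10_comp (w := fun _ => 0) (by fun_prop)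
    exact (((hα.comp hfst hmaps).mul ((h00.pow _).mul (k00.pow _))).add
      ((hβ.comp hfst hmaps).mul ((h01.pow _).mul (k01.pow _))) |>.add
      ((hγ.comp hfst hmaps).mul ((h10.pow _).mul (k10.pow _)))).const_mul _
  refine ⟨fun τ hτ => differentiable_of_joint hd hτ, differentiableOn_left_of_joint hd,
    fun τ hτ => exists_bound_of_joint hd hτ, ?_, fun τ z hτ => ?_, fun τ z hτ => ?_,
    fun τ z hτ => ?_, fun τ z hτ => ?_⟩
  · have hw : ∀ᶠ p : ℂ × ℂ in cuspFilter, |p.2.im| ≤ 1 := eventually_im_cuspFilter.mono fun _ h => h.2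
    have hw0 : ∀ᶠ p : ℂ × ℂ in cuspFilter, |(0 : ℂ).im| ≤ 1 := by simp
    have h := ((cα.mul (((tendsto_theta00_cusp hw).pow (2 * m)).mul
        ((tendsto_theta00_cusp hw0).pow (8 - 2 * m)))).add
      (cβ.mul (((tendsto_theta01_cusp hw).pow (2 * m)).mul
        ((tendsto_theta01_cusp hw0).pow (8 - 2 * m))))).add
      (cγ.mul (((tendsto_theta10_cusp hw).pow (2 * m)).mul
        ((tendsto_theta10_cusp hw0).pow (8 - 2 * m)))) |>.const_mul (1 / 2)
    have h0 : (0 : ℂ) ^ (2 * m) = 0 := zero_pow (by omega)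
    rw [h0] at h
    norm_num at h
    simpa [thetaSum] using h
  · simp only [thetaSum, tα, tβ, tγ, theta00_add_one_left, theta01_add_one_left,
      theta10_pow_add_one_left hm]
    ring
  · have h8 := thetaFactor_pow τ z hm
    have h00 := theta00_neg_inv hτ 0
    have h01 := theta01_neg_inv hτ 0
    have h10 := theta10_neg_inv hτ 0
    rw [zero_div] at h00 h01 h10
    simp only [thetaSum, sα τ hτ, sβ τ hτ, sγ τ hτ, theta00_neg_inv hτ z, theta01_neg_inv hτ z,
      theta10_neg_inv hτ z, h00, h01, h10, mul_pow]
    have h4 : τ ^ (n + 4) * e2 (m * (z ^ 2 / τ)) =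
        τ ^ n * (thetaFactor τ z ^ (2 * m) * thetaFactor τ 0 ^ (8 - 2 * m)) := by rw [h8]; ring
    rw [h4]
    ring
  · simp only [thetaSum, theta00_add_one, theta01_add_one, theta10_add_one,
      (even_two_mul m).neg_pow]
  · have he : cexp (-(Real.pi * I * (τ + 2 * z))) ^ (2 * m) = e2 (-m * (τ + 2 * z)) := by
      rw [← Complex.exp_nat_mul, e2]
      congr 1
      push_cast
      ring
    simp only [thetaSum, theta00_add_self, theta01_add_self, theta10_add_self,
      (even_two_mul m).neg_pow, mul_pow, he]
    ring

/-- The theta function expression of weight `4` Jacobi–Eisenstein series. -/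
lemma EisJ_four_eq {m : ℕ} (hm0 : m ≠ 0) (hm : m < 4) {τ : ℂ} (hτ : 0 < τ.im) (z : ℂ) :
    EisJ 4 m τ z = thetaSum m (fun _ => 1) (fun _ => 1) (fun _ => 1) τ z := by
  have h := (jacobiLike_EisJ le_rfl (by decide : Even 4) hm0).sub
    (jacobiLike_thetaSum (n := 0) hm.le (α := fun _ => 1) (β := fun _ => 1) (γ := fun _ => 1)
      (by fun_prop) (by fun_prop) (by fun_prop) tendsto_const_nhds tendsto_const_nhds
      tendsto_const_nhds (by simp) (by simp) (by simp) (by simp) (by simp) (by simp) hm0)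
  rw [sub_self] at h
  exact sub_eq_zero.mp (h.eq_zero hm0 (by omega) hτ z)

lemma theta10_zero_pow_four_add_one_left (τ : ℂ) :
    theta10 (τ + 1) 0 ^ 4 = -theta10 τ 0 ^ 4 := by
  rw [theta10_add_one_left, mul_pow, ← Complex.exp_nat_mul, show ((4 : ℕ) : ℂ) *
    (Real.pi * I / 4) = Real.pi * I by push_cast; ring, Complex.exp_pi_mul_I, neg_one_mul]

lemma thetaFactor_zero_pow_four (τ : ℂ) : thetaFactor τ 0 ^ 4 = -τ ^ 2 := by
  have hs : ((-I * τ) ^ (1 / 2 : ℂ)) ^ 4 = -τ ^ 2 := by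
    rw [← Complex.cpow_nat_mul, show ((4 : ℕ) : ℂ) * (1 / 2) = (2 : ℕ) by norm_num,
      Complex.cpow_natCast, mul_pow, neg_pow, Complex.I_sq]
    norm_num
  simp [thetaFactor, ← hs]

/-- The theta function expression of weight `6` Jacobi–Eisenstein series. -/
lemma EisJ_six_eq {m : ℕ} (hm0 : m ≠ 0) (hm : m < 3) {τ : ℂ} (hτ : 0 < τ.im) (z : ℂ) :
    EisJ 6 m τ z = thetaSum m (fun τ => theta01 τ 0 ^ 4 - theta10 τ 0 ^ 4)
      (fun τ => theta00 τ 0 ^ 4 + theta10 τ 0 ^ 4)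
      (fun τ => -(theta00 τ 0 ^ 4 + theta01 τ 0 ^ 4)) τ z := by
  have hslice : ∀ {f : ℂ → ℂ → ℂ}, DifferentiableOn ℂ (fun p : ℂ × ℂ => f p.1 0) {p | 0 < p.1.im} →
      DifferentiableOn ℂ (fun τ => f τ 0 ^ 4) {τ | 0 < τ.im} := fun {f} h =>
    (differentiableOn_left_of_joint (φ := fun τ _ => f τ 0) h 0).pow 4
  have d00 := hslice (differentiableOn_theta00_comp (w := fun _ => 0) (by fun_prop))
  have d01 := hslice (differentiableOn_theta01_comp (w := fun _ => 0) (by fun_prop))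
  have d10 := hslice (differentiableOn_theta10_comp (w := fun _ => 0) (by fun_prop))
  have hw0 : ∀ᶠ p : ℂ × ℂ in cuspFilter, |(0 : ℂ).im| ≤ 1 := by simp
  have c00 := (tendsto_theta00_cusp hw0).pow 4
  have c01 := (tendsto_theta01_cusp hw0).pow 4
  have c10 := (tendsto_theta10_cusp hw0).pow 4
  have s00 : ∀ τ, 0 < τ.im → theta00 (-1 / τ) 0 ^ 4 = -τ ^ 2 * theta00 τ 0 ^ 4 := fun τ hτ => by
    have h := theta00_neg_inv hτ 0
    rw [zero_div] at h
    rw [h, mul_pow, thetaFactor_zero_pow_four]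
  have s01 : ∀ τ, 0 < τ.im → theta01 (-1 / τ) 0 ^ 4 = -τ ^ 2 * theta10 τ 0 ^ 4 := fun τ hτ => by
    have h := theta01_neg_inv hτ 0
    rw [zero_div] at h
    rw [h, mul_pow, thetaFactor_zero_pow_four]
  have s10 : ∀ τ, 0 < τ.im → theta10 (-1 / τ) 0 ^ 4 = -τ ^ 2 * theta01 τ 0 ^ 4 := fun τ hτ => by
    have h := theta10_neg_inv hτ 0
    rw [zero_div] at h
    rw [h, mul_pow, thetaFactor_zero_pow_four]
  have h := (jacobiLike_EisJ (by norm_num : 4 ≤ 6) (by decide : Even 6) hm0).sub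
    (jacobiLike_thetaSum (n := 2) (by omega : m ≤ 4) (d01.sub d10) (d00.add d10) (d00.add d01).neg
      (by simpa using c01.sub c10) (by simpa using c00.add c10) (c00.add c01).neg
      (fun τ => ?_) (fun τ => ?_) (fun τ => ?_) (fun τ hτ => ?_) (fun τ hτ => ?_)
      (fun τ hτ => ?_) hm0)
  · rw [sub_self] at h
    exact sub_eq_zero.mp (h.eq_zero hm0 (by omega) hτ z)
  · simp only [Pi.sub_apply, Pi.add_apply, theta01_add_one_left, theta10_zero_pow_four_add_one_left]
    ring
  · simp only [Pi.sub_apply, Pi.add_apply, theta00_add_one_left, theta10_zero_pow_four_add_one_left]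
    ring
  · simp only [Pi.neg_apply, Pi.add_apply, theta00_add_one_left, theta01_add_one_left]
    ring
  · simp only [Pi.sub_apply, s01 τ hτ, s10 τ hτ]
    ring
  · simp only [Pi.add_apply, Pi.neg_apply, s00 τ hτ, s10 τ hτ]
    ring
  · simp only [Pi.add_apply, Pi.neg_apply, s00 τ hτ, s01 τ hτ]
    ring

/-! ### Integrality of theta functions -/

/-- `φ` is the sum of a series `Σ f(n,l) q^{n/2} ζˡ` with integral coefficients, given with
finitely many repetitions of each power of `q`. -/
def HasHalfIntegralExpansion (φ : ℂ → ℂ → ℂ) : Prop :=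
  ∃ (ι : Type) (N : ι → ℕ) (L c : ι → ℤ), (∀ n, {i | N i ≤ n}.Finite) ∧ ∀ τ z : ℂ, 0 < τ.im →
    HasSum (fun i => (c i : ℂ) * e2 (N i * (τ / 2) + L i * z)) (φ τ z)

lemma hasSum_prod_mul {ι ι' : Type*} {f : ι → ℂ} {g : ι' → ℂ} {a b : ℂ} (hf : HasSum f a)
    (hg : HasSum g b) : HasSum (fun i : ι × ι' => f i.1 * g i.2) (a * b) :=
  hf.mul hg (summable_mul_of_summable_norm hf.summable.norm hg.summable.norm)

namespace HasHalfIntegralExpansion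

variable {φ ψ : ℂ → ℂ → ℂ}

lemma congr (h : HasHalfIntegralExpansion φ) (hφψ : ∀ τ z, 0 < τ.im → ψ τ z = φ τ z) :
    HasHalfIntegralExpansion ψ := by
  obtain ⟨ι, N, L, c, hN, h⟩ := h
  exact ⟨ι, N, L, c, hN, fun τ z hτ => hφψ τ z hτ ▸ h τ z hτ⟩

lemma mul (hφ : HasHalfIntegralExpansion φ) (hψ : HasHalfIntegralExpansion ψ) :
    HasHalfIntegralExpansion fun τ z => φ τ z * ψ τ z := by
  obtain ⟨ι, N, L, c, hN, h⟩ := hφ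
  obtain ⟨ι', N', L', c', hN', h'⟩ := hψ
  refine ⟨ι × ι', fun i => N i.1 + N' i.2, fun i => L i.1 + L' i.2, fun i => c i.1 * c' i.2,
    fun n => ((hN n).prod (hN' n)).subset fun i hi => ?_, fun τ z hτ => ?_⟩
  · simp only [Set.mem_ofPred_eq] at hi
    exact ⟨(Nat.le_add_right _ _).trans hi, (Nat.le_add_left _ _).trans hi⟩
  · have h1 := h τ z hτ
    have h2 := h' τ z hτ
    convert hasSum_prod_mul h1 h2 using 2 with i
    push_cast
    rw [mul_mul_mul_comm, ← e2_add]
    ring_nf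

lemma add (hφ : HasHalfIntegralExpansion φ) (hψ : HasHalfIntegralExpansion ψ) :
    HasHalfIntegralExpansion fun τ z => φ τ z + ψ τ z := by
  obtain ⟨ι, N, L, c, hN, h⟩ := hφ
  obtain ⟨ι', N', L', c', hN', h'⟩ := hψ
  refine ⟨ι ⊕ ι', Sum.elim N N', Sum.elim L L', Sum.elim c c', fun n => ?_, fun τ z hτ => ?_⟩
  · refine (((hN n).image Sum.inl).union ((hN' n).image Sum.inr)).subset ?_
    rintro (i | i) hi
    · exact Or.inl ⟨i, hi, rfl⟩
    · exact Or.inr ⟨i, hi, rfl⟩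
  · exact HasSum.sum (h τ z hτ) (h' τ z hτ)

/-- The monomial `a q^{n/2} ζˡ`. -/
lemma monomial (a : ℤ) (n : ℕ) (l : ℤ) :
    HasHalfIntegralExpansion fun τ z => a * e2 (n * (τ / 2) + l * z) :=
  ⟨Unit, fun _ => n, fun _ => l, fun _ => a, fun _ => Set.toFinite _, fun _ _ _ => hasSum_unique _⟩

lemma const (a : ℤ) : HasHalfIntegralExpansion fun _ _ => a := by
  simpa [e2_zero] using monomial a 0 0

lemma sub (hφ : HasHalfIntegralExpansion φ) (hψ : HasHalfIntegralExpansion ψ) :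
    HasHalfIntegralExpansion fun τ z => φ τ z - ψ τ z :=
  (hφ.add ((const (-1)).mul hψ)).congr fun _ _ _ => by push_cast; ring

lemma pow (hφ : HasHalfIntegralExpansion φ) (n : ℕ) :
    HasHalfIntegralExpansion fun τ z => φ τ z ^ n := by
  induction n with
  | zero => simpa using const 1
  | succ n ih => simpa only [pow_succ] using ih.mul hφ

lemma restrict (hφ : HasHalfIntegralExpansion φ) :
    HasHalfIntegralExpansion fun τ _ => φ τ 0 := by
  obtain ⟨ι, N, L, c, hN, h⟩ := hφ
  exact ⟨ι, N, fun _ => 0, c, hN, fun τ z hτ => by simpa using h τ 0 hτ⟩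

/-- Averaging over `τ` and `τ + 1` keeps the integral powers of `q`. -/
lemma average (hφ : HasHalfIntegralExpansion φ) :
    HasIntegralFourierExpansion fun τ z => 1 / 2 * (φ τ z + φ (τ + 1) z) := by
  obtain ⟨ι, N, L, c, hN, h⟩ := hφ
  let p : ι → ℕ × ℤ := fun i => (N i / 2, L i)
  have hfin : ∀ x, Finite {i // p i = x} := fun x =>
    ((hN (2 * x.1 + 1)).subset fun i (hi : p i = x) => by
      have := congrArg Prod.fst hi
      simp only [p] at this
      simp only [Set.mem_ofPred_eq]
      omega).to_subtype
  refine ⟨fun n l => ∑' i : {i // p i = (n, l)}, if Even (N i) then c i else 0, fun τ z hτ => ?_⟩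
  have hτ1 : 0 < (τ + 1).im := by simpa using hτ
  have h1 := ((h τ z hτ).add (h (τ + 1) z hτ1)).mul_left (1 / 2)
  refine HasSum.sigma ((Equiv.sigmaFiberEquiv p).hasSum_iff.mpr h1) fun ⟨n, l⟩ => ?_
  have := hfin (n, l)
  have := Fintype.ofFinite {i // p i = (n, l)}
  simp only
  rw [tsum_fintype, Int.cast_sum, Finset.sum_mul]
  convert hasSum_fintype _ using 1
  refine Finset.sum_congr rfl fun i _ => ?_
  obtain ⟨i, hi⟩ := i
  obtain ⟨rfl, rfl⟩ := Prod.ext_iff.mp hi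
  have h2 : e2 (N i * ((τ + 1) / 2) + L i * z) =
      (-1) ^ N i * e2 (N i * (τ / 2) + L i * z) := by
    rw [show (N i : ℂ) * ((τ + 1) / 2) + L i * z = N i * (1 / 2) + (N i * (τ / 2) + L i * z) by
      ring, e2_add, e2_nat_mul, e2, show 2 * (Real.pi : ℂ) * I * (1 / 2) = Real.pi * I by ring,
      Complex.exp_pi_mul_I]
  simp only [Function.comp_apply, Equiv.sigmaFiberEquiv, Equiv.coe_fn_mk, h2, p]
  split_ifs with he
  · rw [he.neg_one_pow, one_mul]
    obtain ⟨j, hj⟩ := he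
    rw [hj, show (j + j) / 2 = j by omega]
    push_cast
    ring_nf
  · rw [(Nat.not_even_iff_odd.mp he).neg_one_pow]
    simp

end HasHalfIntegralExpansion

lemma finite_natAbs_sq_le (n : ℕ) : {i : ℤ | i.natAbs ^ 2 ≤ n}.Finite :=
  (Set.finite_Icc (-n : ℤ) n).subset fun i (hi : i.natAbs ^ 2 ≤ n) => by
    have : i.natAbs ≤ n := (Nat.le_self_pow two_ne_zero _).trans hi
    rw [Set.mem_Icc]
    omega

lemma natCast_natAbs_sq (n : ℤ) : ((n.natAbs ^ 2 : ℕ) : ℂ) = (n : ℂ) ^ 2 := by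
  rw [← Int.cast_pow, ← Int.natAbs_sq n, ← Int.cast_natCast, Nat.cast_pow]

lemma hasHalfIntegralExpansion_theta00 : HasHalfIntegralExpansion theta00 := by
  refine ⟨ℤ, fun n => n.natAbs ^ 2, fun n => n, fun _ => 1, finite_natAbs_sq_le, fun τ z hτ => ?_⟩
  rw [theta00_eq]
  convert hasSum_jacobiTheta₂_term z hτ using 2 with n
  rw [natCast_natAbs_sq, jacobiTheta₂_term, e2, Int.cast_one, one_mul]
  ring_nf

lemma hasHalfIntegralExpansion_theta01 : HasHalfIntegralExpansion theta01 := by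
  refine ⟨ℤ, fun n => n.natAbs ^ 2, fun n => n, fun n => n.negOnePow,
    finite_natAbs_sq_le, fun τ z hτ => ?_⟩
  rw [theta01_eq]
  convert hasSum_jacobiTheta₂_term (z + 1 / 2) hτ using 2 with n
  rw [natCast_natAbs_sq, Int.cast_negOnePow, jacobiTheta₂_term, e2, ← exp_pi_mul_I_int, ← Complex.exp_add]
  ring_nf

/-- `Σ_{n ∈ ℤ} q^{n(n+1)/2} ζⁿ`. -/
def pronicSeries (τ z : ℂ) : ℂ :=
  ∑' n : ℤ, cexp (Real.pi * I * n * (n + 1) * τ + 2 * Real.pi * I * n * z)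

/-- `Σ_{n ≥ 0} q^{n(n+1)/2}`. -/
def halfPronicSeries (τ : ℂ) : ℂ := ∑' n : ℕ, cexp (Real.pi * I * n * (n + 1) * τ)

lemma hasSum_pronicSeries {τ : ℂ} (hτ : 0 < τ.im) (z : ℂ) :
    HasSum (fun n : ℤ => cexp (Real.pi * I * n * (n + 1) * τ + 2 * Real.pi * I * n * z))
      (pronicSeries τ z) := by
  refine Summable.hasSum ((hasSum_jacobiTheta₂_term (z + τ / 2) hτ).summable.congr fun n => ?_)
  rw [jacobiTheta₂_term]
  ring_nf

lemma tsum_int_eq_two_mul_tsum_nat {f : ℤ → ℂ} (hf : Summable f)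
    (h : ∀ n : ℕ, f (-((n : ℤ) + 1)) = f n) : ∑' n, f n = 2 * ∑' n : ℕ, f n := by
  have h1 := hf.comp_injective (i := fun n : ℕ => (n : ℤ)) Nat.cast_injective
  have h2 : Summable fun n : ℕ => f (-((n : ℤ) + 1)) := by simpa only [h, Function.comp_def] using h1
  rw [tsum_of_nat_of_neg_add_one h1 h2, tsum_congr h, two_mul]

lemma pronicSeries_zero {τ : ℂ} (hτ : 0 < τ.im) :
    pronicSeries τ 0 = 2 * halfPronicSeries τ := by
  rw [pronicSeries, tsum_int_eq_two_mul_tsum_nat (hasSum_pronicSeries hτ 0).summable fun n => ?_,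
    halfPronicSeries]
  · simp
  · push_cast
    ring_nf

lemma hasHalfIntegralExpansion_pronicSeries : HasHalfIntegralExpansion pronicSeries := by
  refine ⟨ℤ, fun n => (n * (n + 1)).toNat, fun n => n, fun _ => 1, fun N => ?_, fun τ z hτ => ?_⟩
  · refine (Set.finite_Icc (-(N : ℤ) - 1) N).subset fun n hn => ?_
    simp only [Int.toNat_le, Set.mem_ofPred_eq] at hn
    rw [Set.mem_Icc]
    constructor <;> nlinarith
  · convert hasSum_pronicSeries hτ z using 2 with n
    have h0 : 0 ≤ n * (n + 1) := by
      rcases le_or_gt 0 n with h | h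
      · positivity
      · nlinarith
    have h : (((n * (n + 1)).toNat : ℕ) : ℂ) = n * (n + 1) := by
      exact_mod_cast congrArg (Int.cast (R := ℂ)) (Int.toNat_of_nonneg h0)
    rw [h, e2, Int.cast_one, one_mul]
    ring_nf

lemma hasHalfIntegralExpansion_halfPronicSeries :
    HasHalfIntegralExpansion fun τ _ => halfPronicSeries τ := by
  refine ⟨ℕ, fun n => n * (n + 1), fun _ => 0, fun _ => 1, fun N => ?_, fun τ z hτ => ?_⟩
  · refine (Set.finite_Iic N).subset fun n hn => ?_
    simp only [Set.mem_ofPred_eq] at hn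
    rw [Set.mem_Iic]
    nlinarith
  · have h := (hasSum_pronicSeries hτ 0).summable.comp_injective (i := fun n : ℕ => (n : ℤ))
      Nat.cast_injective
    have h' : HasSum (fun n : ℕ => cexp (Real.pi * I * n * (n + 1) * τ)) (halfPronicSeries τ) :=
      (h.congr fun n => by simp).hasSum
    convert h' using 2 with n
    rw [e2]
    push_cast
    ring_nf

lemma theta10_eq_mul_pronicSeries (τ z : ℂ) :
    theta10 τ z = cexp (Real.pi * I * τ / 4 + Real.pi * I * z) * pronicSeries τ z := by
  rw [theta10, Complex.exp_add]
  rfl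

lemma hasHalfIntegralExpansion_theta10_zero_pow_four :
    HasHalfIntegralExpansion fun τ _ => theta10 τ 0 ^ 4 :=
  ((HasHalfIntegralExpansion.monomial 16 1 0).mul
    (hasHalfIntegralExpansion_halfPronicSeries.pow 4)).congr fun τ z hτ => by
      rw [theta10_eq_mul_pronicSeries, pronicSeries_zero hτ, mul_pow, ← Complex.exp_nat_mul, e2]
      push_cast
      ring_nf

lemma hasHalfIntegralExpansion_theta10_mul {m : ℕ} (hm : m < 4) :
    HasHalfIntegralExpansion fun τ z =>
      1 / 2 * (theta10 τ z ^ (2 * m) * theta10 τ 0 ^ (8 - 2 * m)) := by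
  obtain ⟨j, hj⟩ : ∃ j, 8 - 2 * m = j + 1 := ⟨7 - 2 * m, by omega⟩
  refine (((HasHalfIntegralExpansion.monomial (2 ^ j) 2 m).mul
    (hasHalfIntegralExpansion_pronicSeries.pow (2 * m))).mul
    (hasHalfIntegralExpansion_halfPronicSeries.pow (j + 1))).congr fun τ z hτ => ?_
  have he : cexp (Real.pi * I * τ / 4 + Real.pi * I * z) ^ (2 * m) *
      cexp (Real.pi * I * τ / 4 + Real.pi * I * 0) ^ (j + 1) =
      e2 ((2 : ℕ) * (τ / 2) + (m : ℤ) * z) := by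
    rw [← Complex.exp_nat_mul, ← Complex.exp_nat_mul, ← Complex.exp_add, e2]
    congr 1
    have h : ((j + 1 : ℕ) : ℂ) = 8 - 2 * m := by
      rw [← hj, Nat.cast_sub (by omega)]
      push_cast
      ring
    rw [h]
    push_cast
    ring
  rw [theta10_eq_mul_pronicSeries, theta10_eq_mul_pronicSeries, pronicSeries_zero hτ, hj, mul_pow,
    mul_pow, mul_pow, ← he]
  push_cast
  ring

lemma hasIntegralFourierExpansion_thetaSum {m : ℕ} (hm : m < 4) {α β γ : ℂ → ℂ}
    (hα : HasHalfIntegralExpansion fun τ _ => α τ) (hγ : HasHalfIntegralExpansion fun τ _ => γ τ)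
    (tα : ∀ τ, α (τ + 1) = β τ) (tγ : ∀ τ, γ (τ + 1) = γ τ) :
    HasIntegralFourierExpansion (thetaSum m α β γ) := by
  have h := ((hα.mul ((hasHalfIntegralExpansion_theta00.pow (2 * m)).mul
    (hasHalfIntegralExpansion_theta00.restrict.pow (8 - 2 * m)))).add
    (hγ.mul (hasHalfIntegralExpansion_theta10_mul hm))).average
  convert h using 3 with τ z
  rw [thetaSum, theta10_pow_add_one_left hm.le, tα, tγ, theta00_add_one_left,
    theta00_add_one_left]
  ring

lemma hasIntegralFourierExpansion_EisJ_four {m : ℕ} (hm0 : m ≠ 0) (hm : m < 4) :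
    HasIntegralFourierExpansion (EisJ 4 m) := by
  have h1 : HasHalfIntegralExpansion fun _ _ => 1 := by
    simpa using HasHalfIntegralExpansion.const 1
  obtain ⟨f, hf⟩ := hasIntegralFourierExpansion_thetaSum hm h1 h1
    (β := fun _ => 1) (fun _ => rfl) fun _ => rfl
  exact ⟨f, fun τ z hτ => EisJ_four_eq hm0 hm hτ z ▸ hf τ z hτ⟩

lemma hasIntegralFourierExpansion_EisJ_six {m : ℕ} (hm0 : m ≠ 0) (hm : m < 3) :
    HasIntegralFourierExpansion (EisJ 6 m) := by
  have h00 := hasHalfIntegralExpansion_theta00.restrict.pow 4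
  have h01 := hasHalfIntegralExpansion_theta01.restrict.pow 4
  have hγ : HasHalfIntegralExpansion fun τ _ => -(theta00 τ 0 ^ 4 + theta01 τ 0 ^ 4) :=
    ((HasHalfIntegralExpansion.const (-1)).mul (h00.add h01)).congr fun _ _ _ => by
      push_cast; ring
  obtain ⟨f, hf⟩ := hasIntegralFourierExpansion_thetaSum (by omega : m < 4)
    (h01.sub hasHalfIntegralExpansion_theta10_zero_pow_four) hγ
    (α := fun τ => theta01 τ 0 ^ 4 - theta10 τ 0 ^ 4)
    (β := fun τ => theta00 τ 0 ^ 4 + theta10 τ 0 ^ 4)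
    (fun τ => by rw [theta01_add_one_left, theta10_zero_pow_four_add_one_left]; ring)
    fun τ => by rw [theta00_add_one_left, theta01_add_one_left]; ring
  exact ⟨f, fun τ z hτ => EisJ_six_eq hm0 hm hτ z ▸ hf τ z hτ⟩

/-- the Jacobi–Eisenstein series `E_{4,1}, E_{4,2}, E_{4,3}, E_{6,1}, E_{6,2}`
all have integral Fourier coefficients. -/
theorem eisenstein_integral_fourier :
    HasIntegralFourierExpansion (EisJ 4 1) ∧ HasIntegralFourierExpansion (EisJ 4 2) ∧
    HasIntegralFourierExpansion (EisJ 4 3) ∧ HasIntegralFourierExpansion (EisJ 6 1) ∧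
    HasIntegralFourierExpansion (EisJ 6 2) := by
  exact ⟨hasIntegralFourierExpansion_EisJ_four one_ne_zero (by norm_num),
    hasIntegralFourierExpansion_EisJ_four two_ne_zero (by norm_num),
    hasIntegralFourierExpansion_EisJ_four three_ne_zero (by norm_num),
    hasIntegralFourierExpansion_EisJ_six one_ne_zero (by norm_num),
    hasIntegralFourierExpansion_EisJ_six two_ne_zero (by norm_num)⟩

end JacobiPaper
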